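/- Assume N ≥ 2. Then for any v₀ ∈ L²(Ω;ℝⁿ) and any base state v̄ ∈ L²((0,T)×Ω;ℝⁿ), there exists a maximizer (E,B) ∈ L²((0,T)×Ω;ℝⁿ) × L^∞((0,T)×Ω;Sym(n,ℝ)) of the dual problem defining 𝒥(v₀,v̄,T), and moreover ℭ(Πv̄, Πv₀) ≤ 𝒥(v₀,v̄,T) < +∞, where Π is the spatial averaging operator (Πw)(t,x) = ∫_Ω w(t,y) dy and ℭ(w̄,w₀) = ∫₀ᵀ [−(w₀,w̄) + ½(w̄,w̄)] dt. -/

import Mathlib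

open MeasureTheory Matrix

namespace NashDual

/-! Setup: `Ω = 𝕋^{N×p}` is modelled by `ℤ^{N×p}`-periodic functions on `ℝ^{N×p}`,
with spatial integrals taken over the unit cube (which has unit volume). The unknown has
`n = pN²` components, indexed by triples `(i,j,l)`. -/

/-- Spatial coordinate indices of the torus `𝕋^{N×p}`. -/
abbrev SIdx (N p : ℕ) := Fin N × Fin p

/-- Component indices of the unknown (`n = pN²` of them). -/
abbrev VIdx (N p : ℕ) := Fin N × Fin N × Fin p

/-- A spatial point. -/
abbrev Pt (N p : ℕ) := SIdx N p → ℝ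

/-- A value in `ℝⁿ`. -/
abbrev Vec (N p : ℕ) := VIdx N p → ℝ

/-- An `n×n` real matrix (the symmetric ones are singled out by `Matrix.IsSymm`). -/
abbrev SymM (N p : ℕ) := Matrix (VIdx N p) (VIdx N p) ℝ

/-- The fundamental cell of the torus (unit volume). -/
def cube (N p : ℕ) : Set (Pt N p) := Set.univ.pi fun _ => Set.Ico (0 : ℝ) 1

/-- The linear map `𝔘 : Sym(n,ℝ) → ℝ^N`. -/
noncomputable def mfU (N p : ℕ) (A : SymM N p) (i : Fin N) : ℝ :=
  (1 / 2) * ∑ l : Fin p, (A (i, i, l) (i, i, l)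
    + ∑ j ∈ Finset.univ.filter (fun j => j ≠ i), (A (j, j, l) (i, j, l) + A (i, j, l) (j, j, l)))

/-- The differential operator `L w = −∇(𝔘 w)`, `(Lw)_{(i,j,l)} = −∂_{x_{(j,l)}} (𝔘w)_i`. -/
noncomputable def Lop (N p : ℕ) (w : Pt N p → SymM N p) (x : Pt N p) : Vec N p :=
  fun a => - fderiv ℝ (fun y => mfU N p (w y) a.1) x (Pi.single a.2 1)

/-- The `L²(Ω)` pairing `(f,g)` of two `ℝⁿ`-valued fields on `Ω` (at a fixed time). -/
noncomputable def pV (N p : ℕ) (f g : Pt N p → Vec N p) : ℝ :=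
  ∫ x in cube N p, ∑ a, f x a * g x a

/-- The `L²(Ω)` (Frobenius) pairing `(A,B)` of two matrix-valued fields on `Ω`. -/
noncomputable def pM (N p : ℕ) (A B : Pt N p → SymM N p) : ℝ :=
  ∫ x in cube N p, ∑ a, ∑ b, A x a b * B x a b

/-- The space-time domain `(0,T) × Ω`. -/
def domST (N p : ℕ) (T : ℝ) : Set (ℝ × Pt N p) := (Set.Ioo 0 T) ×ˢ cube N p

/-- The space-time measure on `(0,T) × Ω`. -/
noncomputable def μST (N p : ℕ) (T : ℝ) : Measure (ℝ × Pt N p) :=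
  volume.restrict (domST N p T)

/-- `v₀ ∈ L²(Ω;ℝⁿ) = X^n`. -/
def MemL2Om (N p : ℕ) (f : Pt N p → Vec N p) : Prop :=
  (∀ a, Measurable fun x => f x a) ∧
  IntegrableOn (fun x => ∑ a, (f x a) ^ 2) (cube N p)

/-- `v ∈ L²((0,T)×Ω;ℝⁿ)`. -/
def MemL2V (N p : ℕ) (T : ℝ) (f : ℝ → Pt N p → Vec N p) : Prop :=
  (∀ a, Measurable fun q : ℝ × Pt N p => f q.1 q.2 a) ∧
  IntegrableOn (fun q : ℝ × Pt N p => ∑ a, (f q.1 q.2 a) ^ 2) (domST N p T)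

/-- `B ∈ L^∞((0,T)×Ω; Sym(n,ℝ))`. -/
def MemLinfS (N p : ℕ) (T : ℝ) (B : ℝ → Pt N p → SymM N p) : Prop :=
  (∀ a b, Measurable fun q : ℝ × Pt N p => B q.1 q.2 a b) ∧
  (∀ t x, (B t x).IsSymm) ∧
  ∃ C : ℝ, ∀ᵐ q ∂(μST N p T), ∀ a b, |B q.1 q.2 a b| ≤ C

/-- `M ∈ L¹((0,T)×Ω; Sym(n,ℝ))`. -/
def MemL1S (N p : ℕ) (T : ℝ) (M : ℝ → Pt N p → SymM N p) : Prop :=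
  (∀ a b, Measurable fun q : ℝ × Pt N p => M q.1 q.2 a b) ∧
  (∀ t x, (M t x).IsSymm) ∧
  IntegrableOn (fun q : ℝ × Pt N p => ∑ a, ∑ b, |M q.1 q.2 a b|) (domST N p T)

/-- A smooth test field `Ψ : [0,T] → C^∞(Ω;Sym(n,ℝ))` with `Ψ(0) = 0`: jointly smooth,
spatially `ℤ`-periodic, symmetric-matrix-valued, vanishing at `t = 0`. -/
def TestField (N p : ℕ) (Ψ : ℝ → Pt N p → SymM N p) : Prop :=
  (∀ a b, ContDiff ℝ (⊤ : ℕ∞) fun q : ℝ × Pt N p => Ψ q.1 q.2 a b) ∧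
  (∀ t x i, Ψ t (x + Pi.single i 1) = Ψ t x) ∧
  (∀ t x, (Ψ t x).IsSymm) ∧
  (∀ x, Ψ 0 x = 0)

/-- Time derivative `∂_t Ψ` of a test field. -/
noncomputable def dtPsi (N p : ℕ) (Ψ : ℝ → Pt N p → SymM N p) (t : ℝ) (x : Pt N p) :
    SymM N p :=
  Matrix.of fun a b => deriv (fun s => Ψ s x a b) t

/-- The linear constraint `∫₀ᵀ [(B,∂_tΨ) + (E,LΨ)] dt = 0` for all test fields `Ψ`. -/
def ConstraintEB (N p : ℕ) (T : ℝ) (E : ℝ → Pt N p → Vec N p)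
    (B : ℝ → Pt N p → SymM N p) : Prop :=
  ∀ Ψ, TestField N p Ψ →
    ∫ t in Set.Ioo 0 T, (pM N p (B t) (dtPsi N p Ψ t) + pV N p (E t) (Lop N p (Ψ t))) = 0

/-- The admissible class: `(E,B) ∈ L² × L^∞(Sym)` satisfying the linear constraint. -/
def Admissible (N p : ℕ) (T : ℝ) (E : ℝ → Pt N p → Vec N p)
    (B : ℝ → Pt N p → SymM N p) : Prop :=
  MemL2V N p T E ∧ MemLinfS N p T B ∧ ConstraintEB N p T E B

/-- The tensor square `v ⊗ v`. -/
def tensorSq (N p : ℕ) (w : Vec N p) : SymM N p := vecMulVec w w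

/-- Weak solution of `∂_t v + ∇𝔘(v⊗v) = 0`, `v(0) = v₀` (Burgers-like formulation):
`v ∈ L²` with `∫₀ᵀ [(v−v₀,E) + (v⊗v,B)] dt = 0` for all admissible pairs `(E,B)`. -/
def WeakSolution (N p : ℕ) (T : ℝ) (v₀ : Pt N p → Vec N p)
    (v : ℝ → Pt N p → Vec N p) : Prop :=
  MemL2V N p T v ∧
  ∀ E B, Admissible N p T E B →
    ∫ t in Set.Ioo 0 T,
      (pV N p (fun x => v t x - v₀ x) (E t)
        + pM N p (fun x => tensorSq N p (v t x)) (B t)) = 0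

/-- The saddle-point objective of the primal problem. -/
noncomputable def primalObj (N p : ℕ) (T : ℝ) (v₀ : Pt N p → Vec N p)
    (vb v E : ℝ → Pt N p → Vec N p) (B : ℝ → Pt N p → SymM N p) : ℝ :=
  ∫ t in Set.Ioo 0 T,
    ((1 / 2) * pV N p (fun x => v t x - vb t x) (fun x => v t x - vb t x)
      + pV N p (fun x => v t x - v₀ x) (E t)
      + pM N p (fun x => tensorSq N p (v t x)) (B t))

/-- `ℐ(v₀,v̄,T)`: the inf-sup value of the primal problem. -/
noncomputable def Ifun (N p : ℕ) (T : ℝ) (v₀ : Pt N p → Vec N p)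
    (vb : ℝ → Pt N p → Vec N p) : EReal :=
  ⨅ v : {v : ℝ → Pt N p → Vec N p // MemL2V N p T v},
    ⨆ EB : {EB : (ℝ → Pt N p → Vec N p) × (ℝ → Pt N p → SymM N p) //
        Admissible N p T EB.1 EB.2},
      ((primalObj N p T v₀ vb v.1 EB.1.1 EB.1.2 : ℝ) : EReal)

/-- The functional `𝒦(Q,B)`: infimum over `(z,M) ∈ L² × L¹(Sym)` with `M − z⊗z ⪰ 0` a.e.
of `∫₀ᵀ [(z,Q) + ½(M, I+2B)] dt`. -/
noncomputable def Kfun (N p : ℕ) (T : ℝ) (Q : ℝ → Pt N p → Vec N p)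
    (B : ℝ → Pt N p → SymM N p) : EReal :=
  ⨅ zM : {zM : (ℝ → Pt N p → Vec N p) × (ℝ → Pt N p → SymM N p) //
      MemL2V N p T zM.1 ∧ MemL1S N p T zM.2 ∧
      ∀ᵐ q ∂(μST N p T), (zM.2 q.1 q.2 - tensorSq N p (zM.1 q.1 q.2)).PosSemidef},
    ((∫ t in Set.Ioo 0 T,
        (pV N p (zM.1.1 t) (Q t)
          + (1 / 2) * pM N p (zM.1.2 t) (fun x => 1 + 2 • B t x)) : ℝ) : EReal)

/-- The objective of the dual problem: `∫₀ᵀ [−(v₀,E) + ½(v̄,v̄)] dt + 𝒦(E−v̄,B)`. -/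
noncomputable def dualObj (N p : ℕ) (T : ℝ) (v₀ : Pt N p → Vec N p)
    (vb E : ℝ → Pt N p → Vec N p) (B : ℝ → Pt N p → SymM N p) : EReal :=
  ((∫ t in Set.Ioo 0 T,
      (- pV N p (fun x => v₀ x) (E t) + (1 / 2) * pV N p (vb t) (vb t)) : ℝ) : EReal)
    + Kfun N p T (fun t x => E t x - vb t x) B

/-- Dual admissibility: admissible and `I + 2B ⪰ 0` a.e. in `(0,T)×Ω`. -/
def DualAdmissible (N p : ℕ) (T : ℝ) (E : ℝ → Pt N p → Vec N p)
    (B : ℝ → Pt N p → SymM N p) : Prop :=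
  Admissible N p T E B ∧
  ∀ᵐ q ∂(μST N p T), ((1 : SymM N p) + 2 • B q.1 q.2).PosSemidef

/-- `𝒥(v₀,v̄,T)`: the value of the dual problem. -/
noncomputable def Jfun (N p : ℕ) (T : ℝ) (v₀ : Pt N p → Vec N p)
    (vb : ℝ → Pt N p → Vec N p) : EReal :=
  ⨆ EB : {EB : (ℝ → Pt N p → Vec N p) × (ℝ → Pt N p → SymM N p) //
      DualAdmissible N p T EB.1 EB.2},
    dualObj N p T v₀ vb EB.1.1 EB.1.2

end NashDual

namespace NashDual

/-- The spatial averaging operator `Π`, `(Πw)(x) = ∫_Ω w(y) dy`. -/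
noncomputable def avg (N p : ℕ) (w : Pt N p → Vec N p) : Pt N p → Vec N p :=
  fun _x a => ∫ y in cube N p, w y a

/-- `ℭ(w̄,w₀) = ∫₀ᵀ [−(w₀,w̄) + ½(w̄,w̄)] dt`. -/
noncomputable def CCfun (N p : ℕ) (T : ℝ) (wb : ℝ → Pt N p → Vec N p)
    (w₀ : Pt N p → Vec N p) : ℝ :=
  ∫ t in Set.Ioo 0 T, (- pV N p (fun x => w₀ x) (wb t) + (1 / 2) * pV N p (wb t) (wb t))

open Filter Topology

/-- A decreasing sequence of nonempty closed convex sets in a Hilbert space, the first of which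
is bounded, has a common point. -/
theorem nonempty_iInter_of_antitone_convex {H : Type*} [NormedAddCommGroup H]
    [InnerProductSpace ℝ H] [CompleteSpace H] (C : ℕ → Set H) (hanti : Antitone C)
    (hne : ∀ k, (C k).Nonempty) (hconv : ∀ k, Convex ℝ (C k)) (hcl : ∀ k, IsClosed (C k))
    (hbd : Bornology.IsBounded (C 0)) : (⋂ k, C k).Nonempty := by
  have hex : ∀ k, ∃ v ∈ C k, ∀ w ∈ C k, ‖v‖ ≤ ‖w‖ := by
    intro k
    obtain ⟨v, hv, hvn⟩ := exists_norm_eq_iInf_of_complete_convex (hne k)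
      (hcl k).isComplete (hconv k) 0
    refine ⟨v, hv, fun w hw => ?_⟩
    have h := ciInf_le (f := fun w : C k => ‖(0 : H) - w‖)
      ⟨0, by rintro _ ⟨w, rfl⟩; exact norm_nonneg _⟩ ⟨w, hw⟩
    rw [← hvn] at h
    simpa using h
  choose x hx hmin using hex
  obtain ⟨R, hR⟩ := hbd.exists_norm_le
  have hmono : Monotone fun k => ‖x k‖ ^ 2 := fun i j hij => by
    have := hmin i (x j) (hanti hij (hx j))
    dsimp only
    gcongr
  have hbdd : BddAbove (Set.range fun k => ‖x k‖ ^ 2) := by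
    refine ⟨R ^ 2, ?_⟩
    rintro _ ⟨k, rfl⟩
    have := hR (x k) (hanti (Nat.zero_le k) (hx k))
    dsimp only
    gcongr
  have hkey : ∀ k m, k ≤ m → ‖x m - x k‖ ^ 2 ≤ 2 * (‖x m‖ ^ 2 - ‖x k‖ ^ 2) := by
    intro k m hkm
    have hmid : (1 / 2 : ℝ) • x m + (1 / 2 : ℝ) • x k ∈ C k :=
      hconv k (hanti hkm (hx m)) (hx k) (by norm_num) (by norm_num) (by norm_num)
    have h1 := hmin k _ hmid
    rw [← smul_add, norm_smul] at h1
    have h2 := parallelogram_law_with_norm ℝ (x m) (x k)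
    have h3 : (2 * ‖x k‖) ^ 2 ≤ ‖x m + x k‖ ^ 2 := by
      gcongr
      norm_num at h1
      linarith
    nlinarith
  have hcau : CauchySeq x := by
    have hc := (tendsto_atTop_ciSup hmono hbdd).cauchySeq
    rw [Metric.cauchySeq_iff'] at hc ⊢
    intro ε hε
    obtain ⟨K, hK⟩ := hc (ε ^ 2 / 2) (by positivity)
    refine ⟨K, fun n hn => ?_⟩
    have h1 := hK n hn
    rw [Real.dist_eq] at h1
    have h2 := hkey K n hn
    rw [dist_eq_norm]
    have h3 := (abs_lt.1 h1).2
    exact lt_of_pow_lt_pow_left₀ 2 hε.le (by linarith)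
  obtain ⟨y, hy⟩ := cauchySeq_tendsto_of_complete hcau
  refine ⟨y, Set.mem_iInter.2 fun k => (hcl k).mem_of_tendsto hy ?_⟩
  filter_upwards [eventually_ge_atTop k] with m hm using hanti hm (hx m)

theorem measurableSet_cube (N p : ℕ) : MeasurableSet (cube N p) :=
  MeasurableSet.univ_pi fun _ => measurableSet_Ico

theorem volume_cube (N p : ℕ) : volume (cube N p) = 1 := by
  simp [cube, Real.volume_pi_Ico]

instance isProbabilityMeasure_cube (N p : ℕ) :
    IsProbabilityMeasure (volume.restrict (cube N p)) :=
  ⟨by rw [Measure.restrict_apply_univ, volume_cube]⟩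

theorem μST_eq_prod (N p : ℕ) (T : ℝ) :
    μST N p T = (volume.restrict (Set.Ioo 0 T)).prod (volume.restrict (cube N p)) := by
  rw [μST, domST, Measure.prod_restrict, Measure.volume_eq_prod]

instance isFiniteMeasure_μST (N p : ℕ) (T : ℝ) : IsFiniteMeasure (μST N p T) := by
  rw [μST_eq_prod]
  infer_instance

theorem integral_iterated {N p : ℕ} {T : ℝ} {F : ℝ × Pt N p → ℝ}
    (hF : Integrable F (μST N p T)) :
    ∫ t in Set.Ioo 0 T, ∫ x in cube N p, F (t, x) = ∫ q, F q ∂(μST N p T) := by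
  rw [μST_eq_prod] at hF ⊢
  exact (integral_prod F hF).symm

theorem integrable_iterated {N p : ℕ} {T : ℝ} {F : ℝ × Pt N p → ℝ}
    (hF : Integrable F (μST N p T)) :
    Integrable (fun t => ∫ x in cube N p, F (t, x)) (volume.restrict (Set.Ioo 0 T)) := by
  rw [μST_eq_prod] at hF
  exact hF.integral_prod_left

theorem isAddFundamentalDomain_cube_shift (N p : ℕ) (s : Pt N p) :
    IsAddFundamentalDomain (Submodule.span ℤ (Set.range (Pi.basisFun ℝ (SIdx N p))))
      ((fun x => x + s) ⁻¹' cube N p) volume := by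
  refine IsAddFundamentalDomain.mk'
    (((measurable_add_const s) (measurableSet_cube N p)).nullMeasurableSet) fun x => ?_
  have h := ZSpan.exist_unique_vadd_mem_fundamentalDomain (Pi.basisFun ℝ (SIdx N p)) (x + s)
  rw [ZSpan.fundamentalDomain_pi_basisFun] at h
  simpa only [Set.mem_preimage, Submodule.vadd_def, vadd_eq_add, add_assoc, cube] using h

theorem periodic_span {N p : ℕ} {u : Pt N p → ℝ} (hu : ∀ x i, u (x + Pi.single i 1) = u x)
    {g : Pt N p} (hg : g ∈ Submodule.span ℤ (Set.range (Pi.basisFun ℝ (SIdx N p)))) :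
    ∀ x, u (g + x) = u x := by
  induction hg using Submodule.span_induction with
  | mem y hy =>
    obtain ⟨i, rfl⟩ := hy
    intro x
    rw [Pi.basisFun_apply, add_comm, hu]
  | zero => simp
  | add a b _ _ ha hb => intro x; rw [add_assoc, ha, hb]
  | smul n a _ ha =>
    have hper : Function.Periodic u a := fun x => by rw [add_comm, ha]
    intro x
    rw [add_comm]
    exact hper.zsmul n x

theorem setIntegral_cube_shift {N p : ℕ} {u : Pt N p → ℝ}
    (hu : ∀ x i, u (x + Pi.single i 1) = u x) (s : Pt N p) :
    ∫ x in cube N p, u (x + s) = ∫ x in cube N p, u x := by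
  have h0 : IsAddFundamentalDomain (Submodule.span ℤ (Set.range (Pi.basisFun ℝ (SIdx N p))))
      (cube N p) volume := by
    simpa using isAddFundamentalDomain_cube_shift N p 0
  have : VAddInvariantMeasure (Submodule.span ℤ (Set.range (Pi.basisFun ℝ (SIdx N p))))
      (Pt N p) volume :=
    inferInstanceAs <| VAddInvariantMeasure
      (Submodule.span ℤ (Set.range (Pi.basisFun ℝ (SIdx N p)))).toAddSubgroup (Pt N p) volume
  rw [h0.setIntegral_eq (isAddFundamentalDomain_cube_shift N p s)]
  · exact (measurePreserving_add_right volume s).setIntegral_preimage_emb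
      (measurableEmbedding_addRight s) u (cube N p)
  · intro g x
    rw [Submodule.vadd_def, vadd_eq_add, add_assoc]
    exact periodic_span hu g.2 _

theorem cube_subset_Icc (N p : ℕ) : cube N p ⊆ Set.Icc 0 1 := fun _ hx =>
  ⟨fun i => (hx i trivial).1, fun i => (hx i trivial).2.le⟩

/-- A partial derivative of a periodic function has zero mean over the cell. -/
theorem setIntegral_fderiv_eq_zero {N p : ℕ} {u : Pt N p → ℝ} (hd : ContDiff ℝ 1 u)
    (hu : ∀ x i, u (x + Pi.single i 1) = u x) (i : SIdx N p) :
    ∫ x in cube N p, fderiv ℝ u x (Pi.single i 1) = 0 := by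
  set e : Pt N p := Pi.single i 1 with he
  have hDc : Continuous fun x => fderiv ℝ u x e :=
    (hd.continuous_fderiv one_ne_zero).clm_apply continuous_const
  have hDp : ∀ x j, fderiv ℝ u (x + Pi.single j 1) e = fderiv ℝ u x e := by
    intro x j
    have h : (fun y => u (y + Pi.single j 1)) = u := funext fun y => hu y j
    rw [← fderiv_comp_add_right, h]
  have hint : Integrable (Function.uncurry fun (s : ℝ) (x : Pt N p) => fderiv ℝ u (x + s • e) e)
      ((volume.restrict (Set.Ioc 0 1)).prod (volume.restrict (cube N p))) := by
    rw [Measure.prod_restrict]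
    have hc : Continuous (Function.uncurry fun (s : ℝ) (x : Pt N p) =>
        fderiv ℝ u (x + s • e) e) := by
      exact hDc.comp (by fun_prop : Continuous fun q : ℝ × Pt N p => q.2 + q.1 • e)
    exact (hc.continuousOn.integrableOn_compact (isCompact_Icc.prod isCompact_Icc)).mono_set
      (Set.prod_mono Set.Ioc_subset_Icc_self (cube_subset_Icc N p))
  have hswap := integral_integral_swap hint
  have hleft : ∫ s in Set.Ioc (0 : ℝ) 1, ∫ x in cube N p, fderiv ℝ u (x + s • e) e
      = ∫ x in cube N p, fderiv ℝ u x e := by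
    have hs := fun s : ℝ => setIntegral_cube_shift (u := fun x => fderiv ℝ u x e) hDp (s • e)
    simp [hs]
  have hright : ∀ x, ∫ s in Set.Ioc (0 : ℝ) 1, fderiv ℝ u (x + s • e) e = 0 := by
    intro x
    rw [← intervalIntegral.integral_of_le zero_le_one,
      intervalIntegral.integral_eq_sub_of_hasDerivAt (f := fun s : ℝ => u (x + s • e))]
    · simp [he, hu]
    · intro s _
      have h1 : HasDerivAt (fun s : ℝ => x + s • e) e s := by
        simpa using ((hasDerivAt_id s).smul_const e).const_add x
      exact ((hd.differentiable one_ne_zero) (x + s • e)).hasFDerivAt.comp_hasDerivAt s h1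
    · exact (hDc.comp (by fun_prop : Continuous fun s : ℝ => x + s • e)).intervalIntegrable _ _
  rw [← hleft, hswap]
  simp [hright]

/-- Reduction of a point to the fundamental cell. -/
noncomputable def cellRep (N p : ℕ) (x : Pt N p) : Pt N p := fun i => Int.fract (x i)

/-- The open fundamental cell. -/
def openCube (N p : ℕ) : Set (Pt N p) := Set.univ.pi fun _ => Set.Ioo (0 : ℝ) 1

theorem cellRep_eq_self {N p : ℕ} {x : Pt N p} (hx : x ∈ cube N p) : cellRep N p x = x :=
  funext fun i => Int.fract_eq_self.2 (hx i trivial)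

theorem cellRep_add_single {N p : ℕ} (x : Pt N p) (i : SIdx N p) :
    cellRep N p (x + Pi.single i 1) = cellRep N p x := by
  funext j
  by_cases h : j = i
  · subst h; simp [cellRep]
  · simp [cellRep, h]

theorem contDiff_periodization {N p : ℕ} {g : ℝ × Pt N p → ℝ} (hg : ContDiff ℝ (⊤ : ℕ∞) g)
    (hc : HasCompactSupport g) (hs : tsupport g ⊆ Set.univ ×ˢ openCube N p) :
    ContDiff ℝ (⊤ : ℕ∞) fun q : ℝ × Pt N p => g (q.1, cellRep N p q.2) := by
  rw [contDiff_iff_contDiffAt]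
  rintro ⟨t, x⟩
  by_cases hx : ∀ i, Int.fract (x i) ≠ 0
  · have hev : ∀ᶠ q : ℝ × Pt N p in 𝓝 (t, x), ∀ i, ⌊q.2 i⌋ = ⌊x i⌋ := by
      rw [eventually_all]
      intro i
      have hopen : IsOpen (Set.Ioo (⌊x i⌋ : ℝ) (⌊x i⌋ + 1)) := isOpen_Ioo
      have hcont : ContinuousAt (fun q : ℝ × Pt N p => q.2 i) (t, x) := by fun_prop
      have hmem : (t, x).2 i ∈ Set.Ioo (⌊x i⌋ : ℝ) (⌊x i⌋ + 1) := by
        refine ⟨lt_of_le_of_ne (Int.floor_le _) fun h => hx i ?_, Int.lt_floor_add_one _⟩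
        rw [Int.fract]
        exact sub_eq_zero.2 h.symm
      filter_upwards [hcont.eventually_mem (hopen.mem_nhds hmem)] with q hq
      exact Int.floor_eq_iff.2 ⟨hq.1.le, hq.2⟩
    have hsm : ContDiffAt ℝ (⊤ : ℕ∞)
        (fun q : ℝ × Pt N p => g (q.1, fun i => q.2 i - (⌊x i⌋ : ℝ))) (t, x) := by
      apply ContDiff.contDiffAt
      apply hg.comp
      fun_prop
    refine hsm.congr_of_eventuallyEq ?_
    filter_upwards [hev] with q hq
    congr 2
    funext i
    rw [cellRep, Int.fract, hq i]
  · push Not at hx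
    obtain ⟨i, hi⟩ := hx
    have hK : IsCompact ((fun q : ℝ × Pt N p => q.2 i) '' tsupport g) :=
      hc.isCompact.image (by fun_prop)
    have hO : IsOpen ((fun q : ℝ × Pt N p => q.2 i) '' tsupport g)ᶜ := hK.isClosed.isOpen_compl
    have h0 : (0 : ℝ) ∈ ((fun q : ℝ × Pt N p => q.2 i) '' tsupport g)ᶜ := by
      rintro ⟨q, hq, h⟩
      exact absurd h ((hs hq).2 i trivial).1.ne'
    have h1 : (1 : ℝ) ∈ ((fun q : ℝ × Pt N p => q.2 i) '' tsupport g)ᶜ := by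
      rintro ⟨q, hq, h⟩
      exact absurd h ((hs hq).2 i trivial).2.ne
    obtain ⟨ε₀, hε₀, hb₀⟩ := Metric.isOpen_iff.1 hO 0 h0
    obtain ⟨ε₁, hε₁, hb₁⟩ := Metric.isOpen_iff.1 hO 1 h1
    have hev : ∀ᶠ q : ℝ × Pt N p in 𝓝 (t, x), |q.2 i - x i| < min (min ε₀ ε₁) 1 := by
      have hcont : ContinuousAt (fun q : ℝ × Pt N p => |q.2 i - x i|) (t, x) := by fun_prop
      apply hcont.eventually_lt_const
      simp [hε₀, hε₁]
    refine (contDiffAt_const (c := (0 : ℝ))).congr_of_eventuallyEq ?_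
    filter_upwards [hev] with q hq
    apply image_eq_zero_of_notMem_tsupport
    intro hmem
    have hnot : cellRep N p q.2 i ∉ ((fun q : ℝ × Pt N p => q.2 i) '' tsupport g)ᶜ :=
      fun h => h ⟨_, hmem, rfl⟩
    apply hnot
    obtain ⟨n, hn⟩ : ∃ n : ℤ, x i = n := ⟨⌊x i⌋, by
      rw [Int.fract] at hi; linarith⟩
    rw [lt_min_iff, lt_min_iff, abs_lt, abs_lt, abs_lt, hn] at hq
    by_cases hge : (n : ℝ) ≤ q.2 i
    · have hfl : ⌊q.2 i⌋ = n := Int.floor_eq_iff.2 ⟨hge, by linarith [hq.2.2]⟩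
      apply hb₀
      rw [Metric.mem_ball, Real.dist_eq, cellRep, Int.fract, hfl, abs_lt]
      constructor <;> linarith [hq.1.1.1, hq.1.1.2]
    · have hfl : ⌊q.2 i⌋ = n - 1 := by
        rw [Int.floor_eq_iff]; push_cast; push Not at hge
        constructor <;> linarith [hq.2.1]
      apply hb₁
      rw [Metric.mem_ball, Real.dist_eq, cellRep, Int.fract, hfl, abs_lt]
      push_cast
      constructor <;> linarith [hq.1.2.1, hq.1.2.2]

/-- A smooth function supported in positive bounded times has a smooth time primitive. -/
theorem exists_time_primitive {N p : ℕ} {g : ℝ × Pt N p → ℝ} (hg : ContDiff ℝ (⊤ : ℕ∞) g)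
    {k : Set ℝ} (hk : IsCompact k) (hkpos : k ⊆ Set.Ioi 0)
    (hgk : ∀ t x, t ∉ k → g (t, x) = 0) :
    ∃ φ : ℝ × Pt N p → ℝ, ContDiff ℝ (⊤ : ℕ∞) φ ∧ (∀ t x, φ (t, x) = ∫ s in (0 : ℝ)..t, g (s, x)) := by
  refine ⟨fun q => ∫ s in (0 : ℝ)..q.1, g (s, q.2), ?_, fun _ _ => rfl⟩
  have hf : LocallyIntegrable (Set.indicator (Set.Ici (0 : ℝ)) fun _ => (1 : ℝ)) volume :=
    (locallyIntegrable_const (1 : ℝ)).indicator measurableSet_Ici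
  have hconv := contDiffOn_convolution_right_with_param (𝕜 := ℝ) (μ := volume) (n := ⊤)
    (ContinuousLinearMap.mul ℝ ℝ) (g := fun (x : Pt N p) (t : ℝ) => g (t, x))
    (s := Set.univ) isOpen_univ hk (fun x t _ ht => hgk t x ht) hf
    (by
      apply ContDiff.contDiffOn
      exact hg.comp (by fun_prop : ContDiff ℝ (⊤ : ℕ∞) fun q : Pt N p × ℝ => (q.2, q.1)))
  rw [Set.univ_prod_univ, contDiffOn_univ] at hconv
  have := hconv.comp (by fun_prop : ContDiff ℝ (⊤ : ℕ∞) fun q : ℝ × Pt N p => (q.2, q.1))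
  convert! this using 1
  funext q
  have hcg : Continuous fun s => g (s, q.2) := hg.continuous.comp (by fun_prop)
  have hint : Integrable fun s => g (s, q.2) :=
    hcg.integrable_of_hasCompactSupport (HasCompactSupport.intro hk fun s hs => hgk s q.2 hs)
  have hsupp : ∫ s in Set.Iic (0 : ℝ), g (s, q.2) = 0 :=
    setIntegral_eq_zero_of_forall_eq_zero fun s hs =>
      hgk _ _ fun h => absurd (hkpos h) (by simpa using hs)
  rw [← intervalIntegral.integral_Iic_sub_Iic hint.integrableOn hint.integrableOn, hsupp, sub_zero,
    Function.comp_apply, convolution_eq_swap, ← integral_indicator measurableSet_Iic]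
  congr 1
  funext s
  by_cases h : s ≤ q.1 <;> simp [Set.indicator, h]

theorem openCube_ae_eq_cube (N p : ℕ) : openCube N p =ᵐ[volume] cube N p :=
  (Measure.univ_pi_Ioo_ae_eq_Icc (μ := fun _ : SIdx N p => (volume : Measure ℝ))
      (f := fun _ => 0) (g := fun _ => 1)).trans
    (Measure.univ_pi_Ico_ae_eq_Icc (μ := fun _ : SIdx N p => (volume : Measure ℝ))
      (f := fun _ => 0) (g := fun _ => 1)).symm

theorem mfU_smul {N p : ℕ} (c : ℝ) (A : SymM N p) (i : Fin N) :
    mfU N p (c • A) i = c * mfU N p A i := by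
  simp only [mfU, Matrix.smul_apply, smul_eq_mul, Finset.mul_sum, mul_add]
  refine Finset.sum_congr rfl fun l _ => ?_
  congr 1
  · ring
  · refine Finset.sum_congr rfl fun l _ => ?_
    ring

theorem integrable_contraction {N p : ℕ} {T : ℝ} {B : ℝ → Pt N p → SymM N p}
    (hB : MemLinfS N p T B) (A : SymM N p) :
    Integrable (fun q : ℝ × Pt N p => ∑ a, ∑ b, B q.1 q.2 a b * A a b) (μST N p T) := by
  obtain ⟨hm, -, C, hC⟩ := hB
  refine integrable_finsetSum _ fun a _ => integrable_finsetSum _ fun b _ => ?_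
  refine Integrable.mul_const ?_ _
  refine Integrable.of_bound (hm a b).aestronglyMeasurable C ?_
  filter_upwards [hC] with q hq using hq a b

/-- The constraint forces `B` to be orthogonal to the kernel of `𝔘` almost everywhere. -/
theorem contraction_ae_eq_zero {N p : ℕ} {T : ℝ} {E : ℝ → Pt N p → Vec N p}
    {B : ℝ → Pt N p → SymM N p} (hEB : Admissible N p T E B) {A : SymM N p} (hA : A.IsSymm)
    (hUA : ∀ i, mfU N p A i = 0) :
    ∀ᵐ q ∂(μST N p T), ∑ a, ∑ b, B q.1 q.2 a b * A a b = 0 := by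
  set f : ℝ × Pt N p → ℝ := fun q => ∑ a, ∑ b, B q.1 q.2 a b * A a b with hf
  have hint : Integrable f (μST N p T) := integrable_contraction hEB.2.1 A
  set U : Set (ℝ × Pt N p) := Set.Ioo 0 T ×ˢ openCube N p with hU
  have hUo : IsOpen U := isOpen_Ioo.prod (isOpen_set_pi Set.finite_univ fun _ _ => isOpen_Ioo)
  have hUd : U ⊆ domST N p T :=
    Set.prod_mono subset_rfl (Set.pi_mono fun _ _ => Set.Ioo_subset_Ico_self)
  have hUae : U =ᵐ[volume] domST N p T := by
    rw [Measure.volume_eq_prod]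
    exact Measure.set_prod_ae_eq (ae_eq_refl _) (openCube_ae_eq_cube N p)
  have hmain : ∀ᵐ q ∂volume, q ∈ U → f q = 0 := by
    apply hUo.ae_eq_zero_of_integral_contDiff_smul_eq_zero
    · exact (IntegrableOn.mono_set hint hUd).locallyIntegrableOn
    intro g hg hgc hgs
    have hgs1 : tsupport g ⊆ Set.univ ×ˢ openCube N p :=
      hgs.trans (Set.prod_mono (Set.subset_univ _) subset_rfl)
    set k : Set ℝ := Prod.fst '' tsupport g with hk
    have hkc : IsCompact k := hgc.isCompact.image continuous_fst
    obtain ⟨φ, hφ, hφe⟩ := exists_time_primitive (contDiff_periodization hg hgc hgs1) hkc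
      (by rintro _ ⟨q, hq, rfl⟩; exact (hgs hq).1.1)
      (fun t x ht => image_eq_zero_of_notMem_tsupport fun h => ht ⟨_, h, rfl⟩)
    have hder : ∀ t x, deriv (fun s => φ (s, x)) t = g (t, cellRep N p x) := by
      intro t x
      simp only [hφe]
      apply Continuous.deriv_integral
      exact (contDiff_periodization hg hgc hgs1).continuous.comp
        (by fun_prop : Continuous fun s : ℝ => (s, x))
    have hΨ : TestField N p fun t x => φ (t, x) • A := by
      refine ⟨fun a b => ?_, fun t x i => ?_, fun t x => ?_, fun x => ?_⟩
      · simp only [Matrix.smul_apply, smul_eq_mul]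
        exact hφ.mul contDiff_const
      · simp only [hφe, cellRep_add_single]
      · exact hA.smul _
      · simp [hφe]
    have hcon := hEB.2.2 _ hΨ
    have hL : ∀ t x, Lop N p (fun x => φ (t, x) • A) x = 0 := by
      intro t x
      funext a
      simp [Lop, mfU_smul, hUA]
    have hdt : ∀ t x a b, dtPsi N p (fun t x => φ (t, x) • A) t x a b
        = g (t, cellRep N p x) * A a b := by
      intro t x a b
      simp only [dtPsi, Matrix.of_apply, Matrix.smul_apply, smul_eq_mul]
      rw [deriv_mul_const_field, hder]
    have hpM : ∀ t, pM N p (B t) (dtPsi N p (fun t x => φ (t, x) • A) t)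
        = ∫ x in cube N p, g (t, x) * f (t, x) := by
      intro t
      refine setIntegral_congr_fun (measurableSet_cube N p) fun x hx => ?_
      simp only [hdt, cellRep_eq_self hx, hf, Finset.mul_sum]
      refine Finset.sum_congr rfl fun a _ => Finset.sum_congr rfl fun b _ => ?_
      ring
    have hgf : Integrable (fun q => g q * f q) (μST N p T) := by
      obtain ⟨C, hC⟩ := hgc.exists_bound_of_continuous hg.continuous
      exact hint.bdd_mul hg.continuous.aestronglyMeasurable (Eventually.of_forall hC)
    simp only [hpM, pV, hL, Pi.zero_apply, mul_zero, Finset.sum_const_zero, integral_zero,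
      add_zero] at hcon
    rw [integral_iterated hgf, μST] at hcon
    rw [← hcon]
    refine (setIntegral_eq_integral_of_forall_compl_eq_zero fun q hq => ?_).symm
    rw [image_eq_zero_of_notMem_tsupport fun h => hq (hUd (hgs h)), zero_smul]
  rw [μST, ← Measure.restrict_congr_set hUae, ae_restrict_iff' hUo.measurableSet]
  exact hmain

theorem sq_le_of_posSemidef {ι : Type*} [Fintype ι] {M : Matrix ι ι ℝ} (hM : M.PosSemidef)
    (a b : ι) : M a b ^ 2 ≤ M a a * M b b := by
  have h := (hM.submatrix ![a, b]).det_nonneg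
  rw [Matrix.det_fin_two] at h
  have hs : M b a = M a b := by simpa using hM.isHermitian.apply a b
  simp [hs] at h
  nlinarith

theorem mfU_single_offdiag {N p : ℕ} {i j : Fin N} (hij : i ≠ j) (l : Fin p) (k : Fin N) :
    mfU N p (Matrix.single (i, j, l) (i, j, l) 1) k = 0 := by
  rw [mfU, Finset.sum_eq_zero, mul_zero]
  intro l' _
  rw [Finset.sum_eq_zero]
  · simp [Matrix.single_apply]; grind
  · intro j' hj'
    simp [Matrix.single_apply]; grind

/-- A symmetric kernel element of `𝔘` coupling a diagonal and an off-diagonal entry. -/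
noncomputable def kerElt (N p : ℕ) (i j : Fin N) (l : Fin p) : SymM N p :=
  Matrix.single (i, i, l) (i, i, l) 1 - (1 / 2 : ℝ) • (Matrix.single (j, j, l) (i, j, l) 1
    + Matrix.single (i, j, l) (j, j, l) 1)

theorem isSymm_kerElt (N p : ℕ) (i j : Fin N) (l : Fin p) : (kerElt N p i j l).IsSymm := by
  rw [Matrix.IsSymm, kerElt]
  simp only [Matrix.transpose_sub, Matrix.transpose_smul, Matrix.transpose_add,
    Matrix.transpose_single, add_comm]

theorem mfU_kerElt {N p : ℕ} {i j : Fin N} (hij : i ≠ j) (l : Fin p) (k : Fin N) :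
    mfU N p (kerElt N p i j l) k = 0 := by
  rw [mfU, Finset.sum_eq_zero, mul_zero]
  intro l' _
  by_cases hk : k = i ∧ l' = l
  · obtain ⟨rfl, rfl⟩ := hk
    rw [Finset.sum_eq_single j]
    · simp [kerElt, hij, hij.symm]; norm_num
    · intro j' _ hne
      simp [kerElt, Matrix.single_apply]; grind
    · intro h
      simp [hij.symm] at h
  · rw [Finset.sum_eq_zero]
    · simp [kerElt, Matrix.single_apply]; grind
    · intro j' hj'
      simp [kerElt, Matrix.single_apply]; grind

theorem contraction_single {N p : ℕ} (B : SymM N p) (a b : VIdx N p) :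
    ∑ c, ∑ d, B c d * Matrix.single a b (1 : ℝ) c d = B a b := by
  rw [Finset.sum_eq_single a, Finset.sum_eq_single b]
  · simp
  · intro d _ hd
    simp [hd.symm]
  · simp
  · intro c _ hc
    simp [hc.symm]
  · simp

theorem contraction_kerElt {N p : ℕ} {B : SymM N p} (hB : B.IsSymm) (i j : Fin N) (l : Fin p) :
    ∑ c, ∑ d, B c d * kerElt N p i j l c d
      = B (i, i, l) (i, i, l) - B (j, j, l) (i, j, l) := by
  have hs : B (i, j, l) (j, j, l) = B (j, j, l) (i, j, l) := hB.apply _ _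
  have h : ∀ c d, B c d * kerElt N p i j l c d
      = B c d * Matrix.single (i, i, l) (i, i, l) (1 : ℝ) c d
        - ((1 / 2) * (B c d * Matrix.single (j, j, l) (i, j, l) (1 : ℝ) c d)
          + (1 / 2) * (B c d * Matrix.single (i, j, l) (j, j, l) (1 : ℝ) c d)) := by
    intro c d
    simp only [kerElt, Matrix.sub_apply, Matrix.smul_apply, Matrix.add_apply, smul_eq_mul]
    ring
  simp only [h, Finset.sum_sub_distrib, Finset.sum_add_distrib, ← Finset.mul_sum,
    contraction_single, hs]
  ring

theorem one_add_two_smul_apply {N p : ℕ} (B : SymM N p) (a b : VIdx N p) :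
    ((1 : SymM N p) + 2 • B) a b = (1 : SymM N p) a b + 2 * B a b := by
  rw [Matrix.add_apply, Matrix.smul_apply, nsmul_eq_mul, Nat.cast_ofNat]

/-- Pointwise bound: positivity of `I + 2B` and orthogonality to the kernel of `𝔘` bound `B`. -/
theorem entry_bound {N p : ℕ} (hN : 2 ≤ N) {B : SymM N p}
    (hpos : ((1 : SymM N p) + 2 • B).PosSemidef)
    (hoff : ∀ i j l, i ≠ j → B (i, j, l) (i, j, l) = 0)
    (hdiag : ∀ i j l, i ≠ j → B (i, i, l) (i, i, l) = B (j, j, l) (i, j, l)) (a b : VIdx N p) :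
    |B a b| ≤ 5 := by
  set M : SymM N p := 1 + 2 • B with hM
  have hMd : ∀ a, M a a = 1 + 2 * B a a := fun a => by
    rw [hM, one_add_two_smul_apply, Matrix.one_apply_eq]
  have hMo : ∀ a b, a ≠ b → M a b = 2 * B a b := fun a b h => by
    rw [hM, one_add_two_smul_apply, Matrix.one_apply_ne h, zero_add]
  have hMdiag : ∀ a, 0 ≤ M a a ∧ M a a ≤ 4 := by
    rintro ⟨i, j, l⟩
    refine ⟨hpos.diag_nonneg, ?_⟩
    by_cases hij : i = j
    · subst hij
      obtain ⟨j, hj⟩ : ∃ j : Fin N, i ≠ j := by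
        have : Nontrivial (Fin N) := Fin.nontrivial_iff_two_le.2 hN
        obtain ⟨j, hj⟩ := exists_ne i
        exact ⟨j, hj.symm⟩
      have key : ∀ i j : Fin N, i ≠ j →
          (M (i, i, l) (i, i, l) - 1) ^ 2 ≤ M (j, j, l) (j, j, l) := by
        intro i j hij
        have h := sq_le_of_posSemidef hpos (j, j, l) (i, j, l)
        rw [hMo _ _ (by simp [hij.symm]), ← hdiag i j l hij, hMd (i, j, l), hoff i j l hij] at h
        rw [hMd (i, i, l)]
        linarith
      have h1 := key i j hj
      have h2 := key j i hj.symm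
      nlinarith [sq_nonneg (M (j, j, l) (j, j, l) - 3 / 2)]
    · rw [hMd, hoff i j l hij]
      norm_num
  have hsq : M a b ^ 2 ≤ 4 ^ 2 := by
    have h := sq_le_of_posSemidef hpos a b
    nlinarith [hMdiag a, hMdiag b, mul_le_mul (hMdiag a).2 (hMdiag b).2 (hMdiag b).1
      (by norm_num : (0 : ℝ) ≤ 4)]
  have habs := abs_le.1 (abs_le_of_sq_le_sq hsq (by norm_num))
  rw [abs_le]
  by_cases hab : a = b
  · subst hab
    rw [hMd] at habs
    constructor <;> linarith
  · rw [hMo a b hab] at habs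
    constructor <;> linarith

theorem DualAdmissible.ae_bound {N p : ℕ} (hN : 2 ≤ N) {T : ℝ} {E : ℝ → Pt N p → Vec N p}
    {B : ℝ → Pt N p → SymM N p} (h : DualAdmissible N p T E B) :
    ∀ᵐ q ∂(μST N p T), ∀ a b, |B q.1 q.2 a b| ≤ 5 := by
  have hoff : ∀ᵐ q ∂(μST N p T), ∀ i j l, i ≠ j → B q.1 q.2 (i, j, l) (i, j, l) = 0 := by
    simp only [ae_all_iff]
    intro i j l hij
    have := contraction_ae_eq_zero h.1 (A := Matrix.single (i, j, l) (i, j, l) 1)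
      (by simp [Matrix.IsSymm]) (mfU_single_offdiag hij l)
    simpa only [contraction_single] using this
  have hdiag : ∀ᵐ q ∂(μST N p T), ∀ i j l, i ≠ j →
      B q.1 q.2 (i, i, l) (i, i, l) = B q.1 q.2 (j, j, l) (i, j, l) := by
    simp only [ae_all_iff]
    intro i j l hij
    filter_upwards [contraction_ae_eq_zero h.1 (isSymm_kerElt N p i j l) (mfU_kerElt hij l)]
      with q hq
    rw [contraction_kerElt (h.1.2.1.2.1 _ _)] at hq
    linarith
  filter_upwards [h.2, hoff, hdiag] with q h1 h2 h3
  exact entry_bound hN h1 h2 h3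

theorem MemL2V.memLp {N p : ℕ} {T : ℝ} {f : ℝ → Pt N p → Vec N p} (hf : MemL2V N p T f)
    (a : VIdx N p) : MemLp (fun q : ℝ × Pt N p => f q.1 q.2 a) 2 (μST N p T) := by
  rw [memLp_two_iff_integrable_sq (hf.1 a).aestronglyMeasurable]
  refine Integrable.mono' hf.2 ((hf.1 a).pow_const 2).aestronglyMeasurable
    (Eventually.of_forall fun q => ?_)
  rw [Real.norm_of_nonneg (sq_nonneg _)]
  exact Finset.single_le_sum (f := fun a => f q.1 q.2 a ^ 2) (fun _ _ => sq_nonneg _)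
    (Finset.mem_univ a)

theorem MemL2V.of_memLp {N p : ℕ} {T : ℝ} {f : ℝ → Pt N p → Vec N p}
    (hm : ∀ a, Measurable fun q : ℝ × Pt N p => f q.1 q.2 a)
    (hf : ∀ a, MemLp (fun q : ℝ × Pt N p => f q.1 q.2 a) 2 (μST N p T)) : MemL2V N p T f :=
  ⟨hm, integrable_finsetSum _ fun a _ => (hf a).integrable_sq⟩

theorem MemL2Om.memLp_cube {N p : ℕ} {f : Pt N p → Vec N p} (hf : MemL2Om N p f)
    (a : VIdx N p) : MemLp (fun x => f x a) 2 (volume.restrict (cube N p)) := by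
  rw [memLp_two_iff_integrable_sq (hf.1 a).aestronglyMeasurable]
  refine Integrable.mono' hf.2 ((hf.1 a).pow_const 2).aestronglyMeasurable
    (Eventually.of_forall fun q => ?_)
  rw [Real.norm_of_nonneg (sq_nonneg _)]
  exact Finset.single_le_sum (f := fun a => f q a ^ 2) (fun _ _ => sq_nonneg _)
    (Finset.mem_univ a)

theorem MemL2Om.memLp {N p : ℕ} {f : Pt N p → Vec N p} (hf : MemL2Om N p f) (T : ℝ)
    (a : VIdx N p) : MemLp (fun q : ℝ × Pt N p => f q.2 a) 2 (μST N p T) := by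
  have hm : Measurable fun q : ℝ × Pt N p => f q.2 a := (hf.1 a).comp measurable_snd
  rw [memLp_two_iff_integrable_sq hm.aestronglyMeasurable, μST_eq_prod]
  exact (hf.memLp_cube a).integrable_sq.comp_snd _

theorem MemL1S.integrable {N p : ℕ} {T : ℝ} {M : ℝ → Pt N p → SymM N p} (hM : MemL1S N p T M)
    (a b : VIdx N p) : Integrable (fun q : ℝ × Pt N p => M q.1 q.2 a b) (μST N p T) := by
  refine Integrable.mono' hM.2.2 (hM.1 a b).aestronglyMeasurable (Eventually.of_forall fun q => ?_)
  rw [Real.norm_eq_abs]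
  refine le_trans ?_ (Finset.single_le_sum (f := fun a => ∑ b, |M q.1 q.2 a b|)
    (fun _ _ => Finset.sum_nonneg fun _ _ => abs_nonneg _) (Finset.mem_univ a))
  exact Finset.single_le_sum (f := fun b => |M q.1 q.2 a b|) (fun _ _ => abs_nonneg _)
    (Finset.mem_univ b)

theorem integral_iterated_add {N p : ℕ} {T : ℝ} {F G : ℝ × Pt N p → ℝ}
    (hF : Integrable F (μST N p T)) (hG : Integrable G (μST N p T)) (c : ℝ) :
    ∫ t in Set.Ioo 0 T, ((∫ x in cube N p, F (t, x)) + c * ∫ x in cube N p, G (t, x))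
      = ∫ q, F q ∂(μST N p T) + c * ∫ q, G q ∂(μST N p T) := by
  rw [integral_add (integrable_iterated hF) ((integrable_iterated hG).const_mul c),
    integral_const_mul, integral_iterated hF, integral_iterated hG]

theorem integral_iterated_neg_add {N p : ℕ} {T : ℝ} {F G : ℝ × Pt N p → ℝ}
    (hF : Integrable F (μST N p T)) (hG : Integrable G (μST N p T)) (c : ℝ) :
    ∫ t in Set.Ioo 0 T, (-(∫ x in cube N p, F (t, x)) + c * ∫ x in cube N p, G (t, x))
      = -∫ q, F q ∂(μST N p T) + c * ∫ q, G q ∂(μST N p T) := by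
  have h := integral_iterated_add hF.neg hG c
  simpa only [Pi.neg_apply, integral_neg] using h

theorem integral_neg_add_mul_add {α : Type*} [MeasurableSpace α] {μ : Measure α}
    {F₁ F₂ F₃ F₄ : α → ℝ} (h₁ : Integrable F₁ μ) (h₂ : Integrable F₂ μ) (h₃ : Integrable F₃ μ)
    (h₄ : Integrable F₄ μ) (c d : ℝ) :
    ∫ q, (-F₁ q + c * F₂ q + (F₃ q + d * F₄ q)) ∂μ
      = -∫ q, F₁ q ∂μ + c * ∫ q, F₂ q ∂μ + (∫ q, F₃ q ∂μ + d * ∫ q, F₄ q ∂μ) := by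
  have k₁ : Integrable (fun q => -F₁ q) μ := h₁.neg
  have k₂ : Integrable (fun q => c * F₂ q) μ := h₂.const_mul c
  have k₄ : Integrable (fun q => d * F₄ q) μ := h₄.const_mul d
  rw [integral_add (f := fun q => -F₁ q + c * F₂ q) (g := fun q => F₃ q + d * F₄ q)
    (k₁.add k₂) (h₃.add k₄), integral_add k₁ k₂, integral_add h₃ k₄, integral_neg,
    integral_const_mul, integral_const_mul]

/-- The competitors `(z,M)` in the definition of `𝒦`. -/
def KAdm (N p : ℕ) (T : ℝ) (z : ℝ → Pt N p → Vec N p) (M : ℝ → Pt N p → SymM N p) : Prop :=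
  MemL2V N p T z ∧ MemL1S N p T M ∧
    ∀ᵐ q ∂(μST N p T), (M q.1 q.2 - tensorSq N p (z q.1 q.2)).PosSemidef

/-- The space-time density of the dual objective tested against a competitor `(z,M)`. -/
noncomputable def dualDensity {N p : ℕ} (v₀ : Pt N p → Vec N p)
    (vb E z : ℝ → Pt N p → Vec N p) (B M : ℝ → Pt N p → SymM N p) (q : ℝ × Pt N p) : ℝ :=
  -(∑ a, v₀ q.2 a * E q.1 q.2 a) + (1 / 2) * ∑ a, vb q.1 q.2 a * vb q.1 q.2 a
    + (∑ a, z q.1 q.2 a * (E q.1 q.2 a - vb q.1 q.2 a)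
      + (1 / 2) * ∑ a, ∑ b, M q.1 q.2 a b * ((1 : SymM N p) + 2 • B q.1 q.2) a b)

section Integrability

variable {N p : ℕ} {T : ℝ} {v₀ : Pt N p → Vec N p} {vb E z : ℝ → Pt N p → Vec N p}
  {B M : ℝ → Pt N p → SymM N p}

theorem integrable_pairing_v₀ (hv₀ : MemL2Om N p v₀) (hE : MemL2V N p T E) :
    Integrable (fun q : ℝ × Pt N p => ∑ a, v₀ q.2 a * E q.1 q.2 a) (μST N p T) :=
  integrable_finsetSum _ fun a _ => (hv₀.memLp T a).integrable_mul (hE.memLp a)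

theorem integrable_pairing (hz : MemL2V N p T z) (hE : MemL2V N p T E) :
    Integrable (fun q : ℝ × Pt N p => ∑ a, z q.1 q.2 a * E q.1 q.2 a) (μST N p T) :=
  integrable_finsetSum _ fun a _ => (hz.memLp a).integrable_mul (hE.memLp a)

theorem MemL2V.sub (hE : MemL2V N p T E) (hvb : MemL2V N p T vb) :
    MemL2V N p T fun t x => E t x - vb t x :=
  MemL2V.of_memLp (fun a => (hE.1 a).sub (hvb.1 a)) fun a => (hE.memLp a).sub (hvb.memLp a)

theorem integrable_pairing_matrix (hM : MemL1S N p T M) (hB : MemLinfS N p T B) :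
    Integrable (fun q : ℝ × Pt N p =>
      ∑ a, ∑ b, M q.1 q.2 a b * ((1 : SymM N p) + 2 • B q.1 q.2) a b) (μST N p T) := by
  refine integrable_finsetSum _ fun a _ => integrable_finsetSum _ fun b _ => ?_
  simp only [one_add_two_smul_apply]
  obtain ⟨C, hC⟩ := hB.2.2
  refine (hM.integrable a b).mul_bdd (c := |(1 : SymM N p) a b| + 2 * C)
    (((hB.1 a b).const_mul 2).const_add _).aestronglyMeasurable ?_
  filter_upwards [hC] with q hq
  rw [Real.norm_eq_abs]
  refine (abs_add_le _ _).trans ?_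
  rw [abs_mul, abs_two]
  linarith [hq a b]

theorem integrable_dualDensity (hv₀ : MemL2Om N p v₀) (hvb : MemL2V N p T vb)
    (hE : MemL2V N p T E) (hB : MemLinfS N p T B) (hz : MemL2V N p T z) (hM : MemL1S N p T M) :
    Integrable (dualDensity v₀ vb E z B M) (μST N p T) :=
  ((integrable_pairing_v₀ hv₀ hE).neg.add ((integrable_pairing hvb hvb).const_mul _)).add
    ((integrable_pairing hz (hE.sub hvb)).add ((integrable_pairing_matrix hM hB).const_mul _))

theorem integral_dualDensity (hv₀ : MemL2Om N p v₀) (hvb : MemL2V N p T vb)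
    (hE : MemL2V N p T E) (hB : MemLinfS N p T B) (hz : MemL2V N p T z) (hM : MemL1S N p T M) :
    ∫ q, dualDensity v₀ vb E z B M q ∂(μST N p T)
      = (∫ t in Set.Ioo 0 T, (- pV N p (fun x => v₀ x) (E t) + (1 / 2) * pV N p (vb t) (vb t)))
        + ∫ t in Set.Ioo 0 T, (pV N p (z t) ((fun t x => E t x - vb t x) t)
          + (1 / 2) * pM N p (M t) (fun x => 1 + 2 • B t x)) := by
  have h1 := integrable_pairing_v₀ hv₀ hE
  have h2 := integrable_pairing hvb hvb
  have h3 := integrable_pairing hz (hE.sub hvb)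
  have h4 := integrable_pairing_matrix hM hB
  have e1 : (∫ t in Set.Ioo 0 T,
      (- pV N p (fun x => v₀ x) (E t) + (1 / 2) * pV N p (vb t) (vb t))) = _ :=
    integral_iterated_neg_add h1 h2 (1 / 2)
  have e2 : (∫ t in Set.Ioo 0 T, (pV N p (z t) ((fun t x => E t x - vb t x) t)
      + (1 / 2) * pM N p (M t) (fun x => 1 + 2 • B t x))) = _ :=
    integral_iterated_add h3 h4 (1 / 2)
  rw [e1, e2]
  exact integral_neg_add_mul_add h1 h2 h3 h4 _ _

theorem le_dualObj_iff (hv₀ : MemL2Om N p v₀) (hvb : MemL2V N p T vb)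
    (hE : MemL2V N p T E) (hB : MemLinfS N p T B) (c : ℝ) :
    (c : EReal) ≤ dualObj N p T v₀ vb E B ↔
      ∀ z M, KAdm N p T z M → c ≤ ∫ q, dualDensity v₀ vb E z B M q ∂(μST N p T) := by
  set r : ℝ := ∫ t in Set.Ioo 0 T,
    (- pV N p (fun x => v₀ x) (E t) + (1 / 2) * pV N p (vb t) (vb t)) with hr
  have h1 : (c : EReal) ≤ dualObj N p T v₀ vb E B ↔
      ((c - r : ℝ) : EReal) ≤ Kfun N p T (fun t x => E t x - vb t x) B := by
    rw [dualObj, ← hr, EReal.coe_sub, EReal.sub_le_iff_le_add (by simp) (by simp), add_comm]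
  rw [h1, Kfun, le_iInf_iff]
  constructor
  · intro h z M hzM
    have := EReal.coe_le_coe_iff.1 (h ⟨(z, M), hzM⟩)
    rw [integral_dualDensity hv₀ hvb hE hB hzM.1 hzM.2.1, ← hr]
    linarith
  · rintro h ⟨⟨z, M⟩, hzM⟩
    have := h z M hzM
    rw [integral_dualDensity hv₀ hvb hE hB hzM.1 hzM.2.1, ← hr] at this
    exact EReal.coe_le_coe_iff.2 (by linarith)

theorem KAdm.of_tensorSq (hz : MemL2V N p T z) :
    KAdm N p T z fun t x => tensorSq N p (z t x) := by
  have hi : ∀ a b, Integrable (fun q : ℝ × Pt N p => tensorSq N p (z q.1 q.2) a b) (μST N p T) :=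
    fun a b => by
      simp only [tensorSq, Matrix.vecMulVec_apply]
      exact (hz.memLp a).integrable_mul (hz.memLp b)
  refine ⟨hz, ⟨fun a b => ?_, fun t x => ?_, ?_⟩, ?_⟩
  · simp only [tensorSq, Matrix.vecMulVec_apply]
    exact (hz.1 a).mul (hz.1 b)
  · ext a b
    simp [tensorSq, Matrix.vecMulVec_apply, mul_comm]
  · exact integrable_finsetSum _ fun a _ => integrable_finsetSum _ fun b _ => (hi a b).abs
  · refine Eventually.of_forall fun q => ?_
    simp only [sub_self]
    exact Matrix.PosSemidef.zero

/-- The constant controlling the quadratic form of `I + 2B`. -/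
noncomputable def ellConst (N p : ℕ) : ℝ := 1 + 10 * (Fintype.card (VIdx N p) : ℝ)

theorem ellConst_pos (N p : ℕ) : 0 < ellConst N p := by
  unfold ellConst; positivity

theorem quadratic_form_le {B : SymM N p} (hB : ∀ a b, |B a b| ≤ 5) (w : Vec N p) :
    ∑ a, ∑ b, tensorSq N p w a b * ((1 : SymM N p) + 2 • B) a b
      ≤ ellConst N p * ∑ a, w a ^ 2 := by
  have h1 : ∀ a b, tensorSq N p w a b * ((1 : SymM N p) + 2 • B) a b
      ≤ w a * w b * (1 : SymM N p) a b + (5 * w a ^ 2 + 5 * w b ^ 2) := by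
    intro a b
    rw [one_add_two_smul_apply, tensorSq, Matrix.vecMulVec_apply, mul_add]
    have h2 : w a * w b * (2 * B a b) ≤ 5 * w a ^ 2 + 5 * w b ^ 2 := by
      have h := abs_le.1 (hB a b)
      nlinarith [mul_nonneg (sub_nonneg.2 h.2) (sq_nonneg (w a - w b)),
        mul_nonneg (by linarith : 0 ≤ 5 + B a b) (sq_nonneg (w a + w b)),
        mul_nonneg (sub_nonneg.2 h.2) (sq_nonneg (w a + w b)),
        mul_nonneg (by linarith : 0 ≤ 5 + B a b) (sq_nonneg (w a - w b))]
    linarith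
  refine (Finset.sum_le_sum fun a _ => Finset.sum_le_sum fun b _ => h1 a b).trans (le_of_eq ?_)
  simp only [Finset.sum_add_distrib, Matrix.one_apply, mul_ite, mul_one, mul_zero,
    Finset.sum_ite_eq, Finset.mem_univ, if_true, Finset.sum_const, Finset.card_univ, nsmul_eq_mul,
    ← Finset.mul_sum, ellConst]
  simp only [← pow_two]
  ring

/-- The bounding constant in the upper estimate of the dual objective. -/
noncomputable def upperConst (T : ℝ) (v₀ : Pt N p → Vec N p) (vb : ℝ → Pt N p → Vec N p) : ℝ :=
  ∫ q, (∑ a, (ellConst N p * (v₀ q.2 a * v₀ q.2 a) - v₀ q.2 a * vb q.1 q.2 a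
    + (1 / 2) * (vb q.1 q.2 a * vb q.1 q.2 a))) ∂(μST N p T)

theorem exists_dualDensity_le (hv₀ : MemL2Om N p v₀) (hvb : MemL2V N p T vb)
    (hE : MemL2V N p T E) (hB : MemLinfS N p T B)
    (hB5 : ∀ᵐ q ∂(μST N p T), ∀ a b, |B q.1 q.2 a b| ≤ 5) :
    ∃ z M, KAdm N p T z M ∧ ∫ q, dualDensity v₀ vb E z B M q ∂(μST N p T)
      ≤ upperConst T v₀ vb
        - 1 / (4 * ellConst N p) * ∫ q, ∑ a, (E q.1 q.2 a - vb q.1 q.2 a) ^ 2 ∂(μST N p T) := by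
  set C := ellConst N p with hC
  have hCpos : 0 < C := ellConst_pos N p
  set z : ℝ → Pt N p → Vec N p := fun t x a => -(1 / C) * (E t x a - vb t x a) with hzdef
  have hz : MemL2V N p T z :=
    MemL2V.of_memLp (fun a => ((hE.1 a).sub (hvb.1 a)).const_mul _)
      fun a => ((hE.memLp a).sub (hvb.memLp a)).const_mul _
  have hK := KAdm.of_tensorSq hz
  refine ⟨z, _, hK, ?_⟩
  have hi1 : Integrable (fun q : ℝ × Pt N p => ∑ a, (C * (v₀ q.2 a * v₀ q.2 a)
      - v₀ q.2 a * vb q.1 q.2 a + (1 / 2) * (vb q.1 q.2 a * vb q.1 q.2 a))) (μST N p T) :=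
    integrable_finsetSum _ fun a _ =>
      ((((hv₀.memLp T a).integrable_mul (hv₀.memLp T a)).const_mul _).sub
        ((hv₀.memLp T a).integrable_mul (hvb.memLp a))).add
        (((hvb.memLp a).integrable_mul (hvb.memLp a)).const_mul _)
  have hi2 : Integrable (fun q : ℝ × Pt N p => ∑ a, (E q.1 q.2 a - vb q.1 q.2 a) ^ 2)
      (μST N p T) := (hE.sub hvb).2
  rw [upperConst, ← integral_const_mul, ← integral_sub hi1 (hi2.const_mul _)]
  refine integral_mono_ae (integrable_dualDensity hv₀ hvb hE hB hz hK.2.1)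
    (hi1.sub (hi2.const_mul _)) ?_
  filter_upwards [hB5] with q hq
  have hquad := quadratic_form_le hq (z q.1 q.2)
  rw [← hC] at hquad
  unfold dualDensity
  have hle : -(∑ a, v₀ q.2 a * E q.1 q.2 a) + (1 / 2) * ∑ a, vb q.1 q.2 a * vb q.1 q.2 a
      + (∑ a, z q.1 q.2 a * (E q.1 q.2 a - vb q.1 q.2 a)
        + (1 / 2) * (C * ∑ a, z q.1 q.2 a ^ 2))
      ≤ ∑ a, (C * (v₀ q.2 a * v₀ q.2 a) - v₀ q.2 a * vb q.1 q.2 a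
        + (1 / 2) * (vb q.1 q.2 a * vb q.1 q.2 a))
        - 1 / (4 * C) * ∑ a, (E q.1 q.2 a - vb q.1 q.2 a) ^ 2 := by
    rw [Finset.mul_sum, Finset.mul_sum, Finset.mul_sum, Finset.mul_sum, ← Finset.sum_neg_distrib,
      ← Finset.sum_add_distrib, ← Finset.sum_add_distrib, ← Finset.sum_add_distrib,
      ← Finset.sum_sub_distrib]
    refine Finset.sum_le_sum fun a _ => ?_
    simp only [hzdef]
    have hsq : 0 ≤ (1 / C) * (C * v₀ q.2 a + (E q.1 q.2 a - vb q.1 q.2 a) / 2) ^ 2 := by positivity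
    have hCC : 1 / C * C = 1 := by field_simp
    have h4 : 1 / (4 * C) = 1 / C / 4 := by field_simp
    rw [h4]
    obtain ⟨Q, hQ⟩ : ∃ Q, E q.1 q.2 a = Q + vb q.1 q.2 a := ⟨_, (sub_add_cancel _ _).symm⟩
    rw [hQ, add_sub_cancel_right] at hsq ⊢
    generalize 1 / C = D at *
    have e1 : D * (C * v₀ q.2 a + Q / 2) ^ 2
        = C * (v₀ q.2 a * v₀ q.2 a) + v₀ q.2 a * Q + D * Q ^ 2 / 4 := by
      linear_combination (C * v₀ q.2 a ^ 2 + v₀ q.2 a * Q) * hCC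
    have e2 : C * (-D * Q) ^ 2 = D * Q ^ 2 := by linear_combination D * Q ^ 2 * hCC
    rw [e1] at hsq
    rw [e2]
    linarith
  simp only
  linarith

end Integrability

theorem contDiff_mfU {N p : ℕ} {F : Type*} [NormedAddCommGroup F] [NormedSpace ℝ F]
    {n : WithTop ℕ∞} {w : F → SymM N p} (hw : ∀ a b, ContDiff ℝ n fun y => w y a b)
    (i : Fin N) : ContDiff ℝ n fun y => mfU N p (w y) i := by
  unfold mfU
  refine contDiff_const.mul (ContDiff.sum fun l _ => (hw _ _).add (ContDiff.sum fun j _ => ?_))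
  exact (hw _ _).add (hw _ _)

section TestFieldRegularity

variable {N p : ℕ} {Ψ : ℝ → Pt N p → SymM N p}

theorem TestField.contDiff_slice (hΨ : TestField N p Ψ) (t : ℝ) (i : Fin N) :
    ContDiff ℝ 1 fun y => mfU N p (Ψ t y) i := by
  refine contDiff_mfU (fun a b => ?_) i
  exact ((hΨ.1 a b).of_le (by exact_mod_cast le_top)).comp
    (contDiff_prodMk_right t)

theorem TestField.continuous_Lop (hΨ : TestField N p Ψ) (a : VIdx N p) :
    Continuous fun q : ℝ × Pt N p => Lop N p (Ψ q.1) q.2 a := by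
  have hU : ContDiff ℝ 1 fun q : ℝ × Pt N p => mfU N p (Ψ q.1 q.2) a.1 :=
    contDiff_mfU (fun a b => (hΨ.1 a b).of_le (by exact_mod_cast le_top)) _
  have he : (fun q : ℝ × Pt N p => Lop N p (Ψ q.1) q.2 a) = fun q =>
      - fderiv ℝ (fun q : ℝ × Pt N p => mfU N p (Ψ q.1 q.2) a.1) q (0, Pi.single a.2 1) := by
    funext q
    have h1 := (hU.differentiable one_ne_zero q).hasFDerivAt
    have h2 : HasFDerivAt (fun y : Pt N p => (q.1, y))
        (ContinuousLinearMap.inr ℝ ℝ (Pt N p)) q.2 := hasFDerivAt_prodMk_right q.1 q.2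
    have h3 := (HasFDerivAt.comp (f := fun y : Pt N p => (q.1, y)) q.2 h1 h2).fderiv
    have h4 := congrArg (fun L => L (Pi.single a.2 1)) h3
    simp only [Function.comp_def] at h4
    rw [Lop, h4]
    simp
  rw [he]
  exact ((hU.continuous_fderiv one_ne_zero).clm_apply continuous_const).neg

theorem TestField.continuous_dtPsi (hΨ : TestField N p Ψ) (a b : VIdx N p) :
    Continuous fun q : ℝ × Pt N p => dtPsi N p Ψ q.1 q.2 a b := by
  have hU : ContDiff ℝ 1 fun q : ℝ × Pt N p => Ψ q.1 q.2 a b :=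
    (hΨ.1 a b).of_le (by exact_mod_cast le_top)
  have he : (fun q : ℝ × Pt N p => dtPsi N p Ψ q.1 q.2 a b) = fun q =>
      fderiv ℝ (fun q : ℝ × Pt N p => Ψ q.1 q.2 a b) q (1, 0) := by
    funext q
    have h1 := (hU.differentiable one_ne_zero q).hasFDerivAt
    have h2 : HasDerivAt (fun s : ℝ => (s, q.2)) ((1 : ℝ), (0 : Pt N p)) q.1 :=
      (hasDerivAt_id q.1).prodMk (hasDerivAt_const q.1 q.2)
    exact (HasFDerivAt.comp_hasDerivAt (f := fun s : ℝ => (s, q.2)) q.1 h1 h2).deriv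
  rw [he]
  exact (hU.continuous_fderiv one_ne_zero).clm_apply continuous_const

theorem exists_bound_of_continuous {N p : ℕ} (T : ℝ) {F : ℝ × Pt N p → ℝ} (hF : Continuous F) :
    ∃ C, ∀ᵐ q ∂(μST N p T), ‖F q‖ ≤ C := by
  obtain ⟨C, hC⟩ := ((isCompact_Icc (a := (0 : ℝ)) (b := T)).prod
    (isCompact_Icc (a := (0 : Pt N p)) (b := 1))).exists_bound_of_continuousOn hF.continuousOn
  refine ⟨C, ?_⟩
  have hm : MeasurableSet (domST N p T) := measurableSet_Ioo.prod (measurableSet_cube N p)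
  filter_upwards [ae_restrict_mem hm] with q hq
  exact hC q ⟨Set.Ioo_subset_Icc_self hq.1, cube_subset_Icc N p hq.2⟩

theorem TestField.integral_Lop (hΨ : TestField N p Ψ) (t : ℝ) (a : VIdx N p) :
    ∫ x in cube N p, Lop N p (Ψ t) x a = 0 := by
  unfold Lop
  rw [integral_neg, setIntegral_fderiv_eq_zero (hΨ.contDiff_slice t a.1) _ a.2, neg_zero]
  intro x i
  rw [hΨ.2.1]

theorem TestField.integrableOn_Lop (hΨ : TestField N p Ψ) (t : ℝ) (a : VIdx N p) :
    IntegrableOn (fun x => Lop N p (Ψ t) x a) (cube N p) := by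
  have hc : Continuous fun x : Pt N p => Lop N p (Ψ t) x a :=
    (hΨ.continuous_Lop a).comp (Continuous.prodMk_right t)
  exact (hc.continuousOn.integrableOn_compact isCompact_Icc).mono_set (cube_subset_Icc N p)

end TestFieldRegularity

section LowerBound

variable {N p : ℕ} {T : ℝ} {v₀ : Pt N p → Vec N p} {vb z : ℝ → Pt N p → Vec N p}
  {M : ℝ → Pt N p → SymM N p}

theorem sq_integral_le_integral_sq {α : Type*} [MeasurableSpace α] {μ : Measure α}
    [IsProbabilityMeasure μ] {f : α → ℝ} (hf : MemLp f 2 μ) :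
    (∫ x, f x ∂μ) ^ 2 ≤ ∫ x, f x ^ 2 ∂μ := by
  have h1 : Integrable f μ := hf.integrable one_le_two
  have h := (convexOn_pow 2).map_integral_le (μ := μ) (f := fun x => |f x|)
    (continuous_pow 2).continuousOn isClosed_Ici
    (Eventually.of_forall fun x => Set.mem_Ici.2 (abs_nonneg _)) h1.abs
    (by simpa [Function.comp_def] using hf.integrable_sq)
  simp only [sq_abs] at h
  refine le_trans ?_ h
  rw [← sq_abs]
  exact pow_le_pow_left₀ (abs_nonneg _) abs_integral_le_integral_abs 2

theorem measurable_avg (hvb : MemL2V N p T vb) (a : VIdx N p) :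
    Measurable fun t => ∫ y in cube N p, vb t y a :=
  ((hvb.1 a).stronglyMeasurable.integral_prod_right (ν := volume.restrict (cube N p))).measurable

theorem MemL2V.avg (hvb : MemL2V N p T vb) : MemL2V N p T fun t => avg N p (vb t) := by
  have hm : ∀ a, Measurable fun q : ℝ × Pt N p => NashDual.avg N p (vb q.1) q.2 a := fun a =>
    (measurable_avg hvb a).comp measurable_fst
  refine MemL2V.of_memLp hm fun a => ?_
  rw [memLp_two_iff_integrable_sq (hm a).aestronglyMeasurable, μST_eq_prod]
  refine Integrable.comp_fst (f := fun t => (∫ y in cube N p, vb t y a) ^ 2) ?_ _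
  have hsq := (hvb.memLp a).integrable_sq
  refine Integrable.mono' (integrable_iterated hsq)
    ((measurable_avg hvb a).pow_const 2).aestronglyMeasurable ?_
  rw [μST_eq_prod] at hsq
  filter_upwards [hsq.prod_right_ae] with t ht
  rw [Real.norm_of_nonneg (sq_nonneg _)]
  refine sq_integral_le_integral_sq ((memLp_two_iff_integrable_sq ?_).2 ht)
  exact ((hvb.1 a).comp measurable_prodMk_left).aestronglyMeasurable

theorem MemL2Om.avg : MemL2Om N p (avg N p v₀) :=
  ⟨fun _ => measurable_const,
    integrable_const (μ := volume.restrict (cube N p)) (∑ a, (∫ y in cube N p, v₀ y a) ^ 2)⟩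

theorem memLinfS_zero : MemLinfS N p T fun _ _ => 0 :=
  ⟨fun _ _ => measurable_const, fun _ _ => Matrix.isSymm_zero, 0, by simp⟩

theorem dualAdmissible_avg (hvb : MemL2V N p T vb) :
    DualAdmissible N p T (fun t => avg N p (vb t)) (fun _ _ => 0) := by
  refine ⟨⟨hvb.avg, memLinfS_zero, fun Ψ hΨ => ?_⟩, Eventually.of_forall fun q => ?_⟩
  · have h : ∀ t, pM N p (fun _ => 0) (dtPsi N p Ψ t) + pV N p (avg N p (vb t)) (Lop N p (Ψ t))
        = 0 := by
      intro t
      have h1 : pM N p (fun _ => 0) (dtPsi N p Ψ t) = 0 := by simp [pM]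
      rw [h1, zero_add, pV, integral_finsetSum]
      · refine Finset.sum_eq_zero fun a _ => ?_
        simp only [NashDual.avg]
        rw [integral_const_mul, hΨ.integral_Lop, mul_zero]
      · intro a _
        exact (hΨ.integrableOn_Lop t a).const_mul (∫ y in cube N p, vb t y a)
    simp only [h, integral_zero]
  · simpa using Matrix.PosSemidef.one

theorem integral_mul_avg (hvb : MemL2V N p T vb) :
    ∫ q, ∑ a, vb q.1 q.2 a * avg N p (vb q.1) q.2 a ∂(μST N p T)
      = ∫ q, ∑ a, avg N p (vb q.1) q.2 a * avg N p (vb q.1) q.2 a ∂(μST N p T) := by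
  have h1 : ∀ a, Integrable (fun q : ℝ × Pt N p => vb q.1 q.2 a * avg N p (vb q.1) q.2 a)
    (μST N p T) := fun a => (hvb.memLp a).integrable_mul (hvb.avg.memLp a)
  have h2 : ∀ a, Integrable (fun q : ℝ × Pt N p =>
      avg N p (vb q.1) q.2 a * avg N p (vb q.1) q.2 a)
    (μST N p T) := fun a => (hvb.avg.memLp a).integrable_mul (hvb.avg.memLp a)
  rw [integral_finsetSum _ fun a _ => h1 a, integral_finsetSum _ fun a _ => h2 a]
  refine Finset.sum_congr rfl fun a _ => ?_
  rw [← integral_iterated (h1 a), ← integral_iterated (h2 a)]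
  simp only [NashDual.avg, integral_mul_const, integral_const, probReal_univ, one_smul]

theorem integral_avg_mul (hv₀ : MemL2Om N p v₀) (hvb : MemL2V N p T vb) :
    ∫ q, ∑ a, v₀ q.2 a * avg N p (vb q.1) q.2 a ∂(μST N p T)
      = ∫ q, ∑ a, avg N p v₀ q.2 a * avg N p (vb q.1) q.2 a ∂(μST N p T) := by
  have h1 : ∀ a, Integrable (fun q : ℝ × Pt N p => v₀ q.2 a * avg N p (vb q.1) q.2 a)
    (μST N p T) := fun a => (hv₀.memLp T a).integrable_mul (hvb.avg.memLp a)
  have h2 : ∀ a, Integrable (fun q : ℝ × Pt N p => avg N p v₀ q.2 a * avg N p (vb q.1) q.2 a)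
    (μST N p T) := fun a => ((MemL2Om.avg (v₀ := v₀)).memLp T a).integrable_mul (hvb.avg.memLp a)
  rw [integral_finsetSum _ fun a _ => h1 a, integral_finsetSum _ fun a _ => h2 a]
  refine Finset.sum_congr rfl fun a _ => ?_
  rw [← integral_iterated (h1 a), ← integral_iterated (h2 a)]
  simp only [NashDual.avg, integral_mul_const, integral_const, probReal_univ, one_smul]

theorem CCfun_avg_eq (hv₀ : MemL2Om N p v₀) (hvb : MemL2V N p T vb) :
    CCfun N p T (fun t => avg N p (vb t)) (avg N p v₀)
      = -∫ q, ∑ a, v₀ q.2 a * avg N p (vb q.1) q.2 a ∂(μST N p T)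
        + (1 / 2) * ∫ q, ∑ a, avg N p (vb q.1) q.2 a * avg N p (vb q.1) q.2 a ∂(μST N p T) := by
  rw [integral_avg_mul hv₀ hvb]
  exact integral_iterated_neg_add (integrable_pairing_v₀ MemL2Om.avg hvb.avg)
    (integrable_pairing hvb.avg hvb.avg) (1 / 2)

theorem le_dualDensity_of_posSemidef {E : ℝ → Pt N p → Vec N p} {q : ℝ × Pt N p}
    (hM : (M q.1 q.2 - tensorSq N p (z q.1 q.2)).PosSemidef) :
    -(∑ a, v₀ q.2 a * E q.1 q.2 a) + 0 * 0 + (∑ a, vb q.1 q.2 a * E q.1 q.2 a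
      + (-1 / 2) * ∑ a, E q.1 q.2 a * E q.1 q.2 a)
      ≤ dualDensity v₀ vb E z (fun _ _ => 0) M q := by
  have hM' : ∀ a, z q.1 q.2 a * z q.1 q.2 a ≤ M q.1 q.2 a a := fun a => by
    have := hM.diag_nonneg (i := a)
    rw [Matrix.sub_apply, tensorSq, Matrix.vecMulVec_apply] at this
    linarith
  have htr : ∑ a, ∑ b, M q.1 q.2 a b * ((1 : SymM N p) + 2 • (0 : SymM N p)) a b
      = ∑ a, M q.1 q.2 a a := by
    refine Finset.sum_congr rfl fun a _ => ?_
    simp [Matrix.one_apply]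
  rw [dualDensity, htr]
  simp only [Finset.mul_sum, ← Finset.sum_neg_distrib, ← Finset.sum_add_distrib, zero_mul, add_zero]
  refine Finset.sum_le_sum fun a _ => ?_
  nlinarith [hM' a, sq_nonneg (z q.1 q.2 a + (E q.1 q.2 a - vb q.1 q.2 a))]

theorem CCfun_le_dualObj (hv₀ : MemL2Om N p v₀) (hvb : MemL2V N p T vb) :
    ((CCfun N p T (fun t => avg N p (vb t)) (avg N p v₀) : ℝ) : EReal)
      ≤ dualObj N p T v₀ vb (fun t => avg N p (vb t)) (fun _ _ => 0) := by
  rw [le_dualObj_iff hv₀ hvb hvb.avg memLinfS_zero]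
  intro z M hK
  have h1 := integrable_pairing_v₀ hv₀ hvb.avg
  have h3 := integrable_pairing hvb hvb.avg
  have h4 := integrable_pairing hvb.avg hvb.avg
  have h0 : Integrable (fun _ : ℝ × Pt N p => (0 : ℝ)) (μST N p T) := integrable_zero _ _ _
  have hval := integral_neg_add_mul_add h1 h0 h3 h4 0 (-1 / 2)
  have hmono : _ ≤ ∫ q, dualDensity v₀ vb (fun t => avg N p (vb t)) z (fun _ _ => 0) M q
      ∂(μST N p T) :=
    integral_mono_ae ((h1.neg.add (h0.const_mul 0)).add (h3.add (h4.const_mul (-1 / 2))))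
      (integrable_dualDensity hv₀ hvb hvb.avg memLinfS_zero hK.1 hK.2.1)
      (hK.2.2.mono fun q hq => le_dualDensity_of_posSemidef (v₀ := v₀) (vb := vb)
        (E := fun t => avg N p (vb t)) hq)
  refine le_trans (le_of_eq ?_) hmono
  refine Eq.trans ?_ hval.symm
  rw [CCfun_avg_eq hv₀ hvb, integral_mul_avg hvb]
  ring

end LowerBound

/-- Indices of the scalar components of a pair `(E,B)`. -/
abbrev HIdx (N p : ℕ) := VIdx N p ⊕ (VIdx N p × VIdx N p)

/-- The Hilbert space in which pairs `(E,B)` are represented. -/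
abbrev HSp (N p : ℕ) (T : ℝ) := PiLp 2 fun _ : HIdx N p => Lp ℝ 2 (μST N p T)

section Fields

variable {N p : ℕ} {T : ℝ}

/-- The vector field represented by an element of the Hilbert space. -/
noncomputable def Efield (f : HSp N p T) (t : ℝ) (x : Pt N p) : Vec N p :=
  fun a => f (Sum.inl a) (t, x)

/-- The symmetric matrix field represented by an element of the Hilbert space. -/
noncomputable def Bfield (f : HSp N p T) (t : ℝ) (x : Pt N p) : SymM N p :=
  Matrix.of fun a b => (f (Sum.inr (a, b)) (t, x) + f (Sum.inr (b, a)) (t, x)) / 2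

/-- The matrix components of `f` are essentially bounded by `5`. -/
def IsBdd (f : HSp N p T) : Prop :=
  ∀ᵐ q ∂(μST N p T), ∀ i, |f (Sum.inr i) q| ≤ 5

theorem measurable_coe (f : HSp N p T) (i : HIdx N p) :
    Measurable fun q : ℝ × Pt N p => f i (q.1, q.2) :=
  (Lp.stronglyMeasurable (f i)).measurable

theorem memL2V_Efield (f : HSp N p T) : MemL2V N p T (Efield f) :=
  MemL2V.of_memLp (fun _ => measurable_coe f _) fun a => Lp.memLp (f (Sum.inl a))

theorem IsBdd.Bfield {f : HSp N p T} (hf : IsBdd f) :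
    ∀ᵐ q ∂(μST N p T), ∀ a b, |Bfield f q.1 q.2 a b| ≤ 5 := by
  filter_upwards [hf] with q hq a b
  have h1 := abs_le.1 (hq (a, b))
  have h2 := abs_le.1 (hq (b, a))
  simp only [NashDual.Bfield, Matrix.of_apply]
  rw [abs_le]
  constructor <;> linarith [h1.1, h1.2, h2.1, h2.2]

theorem IsBdd.memLinfS {f : HSp N p T} (hf : IsBdd f) : MemLinfS N p T (NashDual.Bfield f) := by
  refine ⟨fun a b => ?_, fun t x => ?_, 5, hf.Bfield⟩
  · exact ((measurable_coe f _).add (measurable_coe f _)).div_const 2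
  · ext a b
    simp only [NashDual.Bfield, Matrix.transpose_apply, Matrix.of_apply, add_comm]

/-- The linear pairing of `(E,B)` with weights `(W,D)`. -/
noncomputable def pairDensity (E : ℝ → Pt N p → Vec N p) (B : ℝ → Pt N p → SymM N p)
    (W : ℝ × Pt N p → Vec N p) (D : ℝ × Pt N p → SymM N p) (q : ℝ × Pt N p) : ℝ :=
  (∑ a, ∑ b, B q.1 q.2 a b * D q a b) + ∑ a, E q.1 q.2 a * W q a

/-- Weights in `L² × L¹`. -/
def GoodWeight (T : ℝ) (W : ℝ × Pt N p → Vec N p) (D : ℝ × Pt N p → SymM N p) : Prop :=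
  (∀ a, MemLp (fun q => W q a) 2 (μST N p T)) ∧ ∀ a b, Integrable (fun q => D q a b) (μST N p T)

variable {E : ℝ → Pt N p → Vec N p} {B : ℝ → Pt N p → SymM N p}
  {W : ℝ × Pt N p → Vec N p} {D : ℝ × Pt N p → SymM N p}

theorem GoodWeight.integrable_matrix (h : GoodWeight T W D) (hB : MemLinfS N p T B)
    (a b : VIdx N p) : Integrable (fun q => B q.1 q.2 a b * D q a b) (μST N p T) := by
  obtain ⟨C, hC⟩ := hB.2.2
  exact (h.2 a b).bdd_mul (hB.1 a b).aestronglyMeasurable (hC.mono fun q hq => hq a b)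

theorem GoodWeight.integrable_vector (h : GoodWeight T W D) (hE : MemL2V N p T E)
    (a : VIdx N p) : Integrable (fun q => E q.1 q.2 a * W q a) (μST N p T) :=
  (hE.memLp a).integrable_mul (h.1 a)

theorem GoodWeight.integrable_sum_matrix (h : GoodWeight T W D) (hB : MemLinfS N p T B) :
    Integrable (fun q => ∑ a, ∑ b, B q.1 q.2 a b * D q a b) (μST N p T) :=
  integrable_finsetSum _ fun a _ => integrable_finsetSum _ fun b _ => h.integrable_matrix hB a b

theorem GoodWeight.integrable_sum_vector (h : GoodWeight T W D) (hE : MemL2V N p T E) :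
    Integrable (fun q => ∑ a, E q.1 q.2 a * W q a) (μST N p T) :=
  integrable_finsetSum _ fun a _ => h.integrable_vector hE a

theorem GoodWeight.integrable (h : GoodWeight T W D) (hE : MemL2V N p T E)
    (hB : MemLinfS N p T B) : Integrable (pairDensity E B W D) (μST N p T) :=
  (h.integrable_sum_matrix hB).add (h.integrable_sum_vector hE)

theorem GoodWeight.integral_eq (h : GoodWeight T W D) (hE : MemL2V N p T E)
    (hB : MemLinfS N p T B) : ∫ q, pairDensity E B W D q ∂(μST N p T)
      = ∑ a, ∑ b, ∫ q, B q.1 q.2 a b * D q a b ∂(μST N p T)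
        + ∑ a, ∫ q, E q.1 q.2 a * W q a ∂(μST N p T) := by
  unfold pairDensity
  rw [integral_add (h.integrable_sum_matrix hB) (h.integrable_sum_vector hE),
    integral_finsetSum _ fun a _ => integrable_finsetSum _ fun b _ => h.integrable_matrix hB a b,
    integral_finsetSum _ fun a _ => h.integrable_vector hE a]
  congr 1
  exact Finset.sum_congr rfl fun a _ => integral_finsetSum _ fun b _ => h.integrable_matrix hB a b

theorem TestField.goodWeight {Ψ : ℝ → Pt N p → SymM N p} (hΨ : TestField N p Ψ) (T : ℝ) :
    GoodWeight T (fun q => Lop N p (Ψ q.1) q.2) fun q => dtPsi N p Ψ q.1 q.2 := by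
  refine ⟨fun a => ?_, fun a b => ?_⟩
  · obtain ⟨C, hC⟩ := exists_bound_of_continuous T (hΨ.continuous_Lop a)
    exact MemLp.of_bound (hΨ.continuous_Lop a).aestronglyMeasurable C hC
  · obtain ⟨C, hC⟩ := exists_bound_of_continuous T (hΨ.continuous_dtPsi a b)
    exact Integrable.of_bound (hΨ.continuous_dtPsi a b).aestronglyMeasurable C hC

theorem constraintEB_iff (hE : MemL2V N p T E) (hB : MemLinfS N p T B) :
    ConstraintEB N p T E B ↔ ∀ Ψ, TestField N p Ψ →
      ∫ q, pairDensity E B (fun q => Lop N p (Ψ q.1) q.2) (fun q => dtPsi N p Ψ q.1 q.2) q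
        ∂(μST N p T) = 0 := by
  refine forall_congr' fun Ψ => forall_congr' fun hΨ => ?_
  have h := hΨ.goodWeight T
  have h1 := h.integrable_sum_matrix hB
  have h2 := h.integrable_sum_vector hE
  have he := integral_add (integrable_iterated h1) (integrable_iterated h2)
  rw [integral_iterated h1, integral_iterated h2, ← integral_add h1 h2] at he
  exact Eq.congr_left he

variable {v₀ : Pt N p → Vec N p} {vb z : ℝ → Pt N p → Vec N p} {M : ℝ → Pt N p → SymM N p}

theorem goodWeight_of_kAdm (hv₀ : MemL2Om N p v₀) (hz : MemL2V N p T z) (hM : MemL1S N p T M) :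
    GoodWeight T (fun q => z q.1 q.2 - v₀ q.2) fun q => M q.1 q.2 :=
  ⟨fun a => (hz.memLp a).sub (hv₀.memLp T a), hM.integrable⟩

/-- The part of the dual density that does not depend on `(E,B)`. -/
noncomputable def freeDensity (vb z : ℝ → Pt N p → Vec N p) (M : ℝ → Pt N p → SymM N p)
    (q : ℝ × Pt N p) : ℝ :=
  dualDensity (fun _ => 0) vb (fun _ _ => 0) z (fun _ _ => 0) M q

theorem dualDensity_eq (q : ℝ × Pt N p) : dualDensity v₀ vb E z B M q
    = freeDensity vb z M q
      + pairDensity E B (fun q => z q.1 q.2 - v₀ q.2) (fun q => M q.1 q.2) q := by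
  have hm : ∑ a, ∑ b, M q.1 q.2 a b * ((1 : SymM N p) + 2 • B q.1 q.2) a b
      = ∑ a, ∑ b, M q.1 q.2 a b * ((1 : SymM N p) + 2 • (0 : SymM N p)) a b
        + 2 * ∑ a, ∑ b, B q.1 q.2 a b * M q.1 q.2 a b := by
    simp only [Finset.mul_sum, ← Finset.sum_add_distrib]
    refine Finset.sum_congr rfl fun a _ => Finset.sum_congr rfl fun b _ => ?_
    rw [one_add_two_smul_apply, one_add_two_smul_apply, Matrix.zero_apply]
    ring
  have hv : -(∑ a, v₀ q.2 a * E q.1 q.2 a) + ∑ a, z q.1 q.2 a * (E q.1 q.2 a - vb q.1 q.2 a)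
      = ∑ a, z q.1 q.2 a * (0 - vb q.1 q.2 a) + ∑ a, E q.1 q.2 a * (z q.1 q.2 a - v₀ q.2 a) := by
    simp only [← Finset.sum_neg_distrib, ← Finset.sum_add_distrib]
    exact Finset.sum_congr rfl fun a _ => by ring
  simp only [freeDensity, dualDensity, pairDensity, Pi.zero_apply, zero_mul, Finset.sum_const_zero,
    Pi.sub_apply]
  rw [hm]
  linear_combination hv

theorem integral_dualDensity_eq (hv₀ : MemL2Om N p v₀) (hvb : MemL2V N p T vb)
    (hE : MemL2V N p T E) (hB : MemLinfS N p T B) (hz : MemL2V N p T z) (hM : MemL1S N p T M) :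
    ∫ q, dualDensity v₀ vb E z B M q ∂(μST N p T) = ∫ q, freeDensity vb z M q ∂(μST N p T)
      + ∫ q, pairDensity E B (fun q => z q.1 q.2 - v₀ q.2) (fun q => M q.1 q.2) q
        ∂(μST N p T) := by
  have h0 : MemL2Om N p (fun _ => (0 : Vec N p)) := ⟨fun _ => measurable_const, by simp⟩
  have h0' : MemL2V N p T (fun _ _ => (0 : Vec N p)) := ⟨fun _ => measurable_const, by simp⟩
  have h1 : Integrable (freeDensity vb z M) (μST N p T) :=
    integrable_dualDensity h0 hvb h0' memLinfS_zero hz hM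
  rw [← integral_add h1 ((goodWeight_of_kAdm hv₀ hz hM).integrable hE hB)]
  exact integral_congr_ae (Eventually.of_forall fun q => dualDensity_eq q)

/-- The pairing as a functional on the Hilbert space. -/
noncomputable def pairing (W : ℝ × Pt N p → Vec N p) (D : ℝ × Pt N p → SymM N p)
    (f : HSp N p T) : ℝ :=
  ∫ q, pairDensity (Efield f) (Bfield f) W D q ∂(μST N p T)

theorem coe_combo (f g : HSp N p T) (α β : ℝ) :
    ∀ᵐ q ∂(μST N p T), ∀ i, (α • f + β • g) i q = α * f i q + β * g i q := by
  rw [ae_all_iff]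
  intro i
  have he : (α • f + β • g) i = α • f i + β • g i := rfl
  rw [he]
  filter_upwards [Lp.coeFn_add (α • f i) (β • g i), Lp.coeFn_smul α (f i),
    Lp.coeFn_smul β (g i)] with q h1 h2 h3
  rw [h1, Pi.add_apply, h2, h3, Pi.smul_apply, Pi.smul_apply, smul_eq_mul, smul_eq_mul]

theorem fields_combo (f g : HSp N p T) (α β : ℝ) :
    ∀ᵐ q ∂(μST N p T), Efield (α • f + β • g) q.1 q.2
        = α • Efield f q.1 q.2 + β • Efield g q.1 q.2 ∧
      Bfield (α • f + β • g) q.1 q.2 = α • Bfield f q.1 q.2 + β • Bfield g q.1 q.2 := by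
  filter_upwards [coe_combo f g α β] with q hq
  constructor
  · funext a
    simp only [Efield, Pi.add_apply, Pi.smul_apply, smul_eq_mul]
    exact hq _
  · ext a b
    simp only [Bfield, Matrix.add_apply, Matrix.smul_apply, Matrix.of_apply, smul_eq_mul]
    rw [hq, hq]
    ring

theorem pairing_combo (h : GoodWeight T W D) {f g : HSp N p T} (hf : IsBdd f) (hg : IsBdd g)
    (α β : ℝ) : pairing W D (α • f + β • g) = α * pairing W D f + β * pairing W D g := by
  unfold pairing
  rw [← integral_const_mul, ← integral_const_mul,
    ← integral_add ((h.integrable (memL2V_Efield f) hf.memLinfS).const_mul α)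
      ((h.integrable (memL2V_Efield g) hg.memLinfS).const_mul β)]
  refine integral_congr_ae ?_
  filter_upwards [fields_combo f g α β] with q hq
  simp only [pairDensity, hq.1, hq.2, Finset.mul_sum, mul_add, Matrix.add_apply,
    Matrix.smul_apply, Pi.add_apply, Pi.smul_apply, smul_eq_mul, add_mul, Finset.sum_add_distrib,
    mul_assoc]
  ring

theorem IsBdd.combo {f g : HSp N p T} (hf : IsBdd f) (hg : IsBdd g) {α β : ℝ} (hα : 0 ≤ α)
    (hβ : 0 ≤ β) (hαβ : α + β = 1) : IsBdd (α • f + β • g) := by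
  filter_upwards [coe_combo f g α β, hf, hg] with q hq h1 h2 i
  rw [hq]
  have k1 := abs_le.1 (h1 i)
  have k2 := abs_le.1 (h2 i)
  rw [abs_le]
  constructor <;> nlinarith [k1.1, k1.2, k2.1, k2.2]

theorem exists_subseq_tendsto_ae {F : ℕ → HSp N p T} {f : HSp N p T}
    (hF : Tendsto F atTop (𝓝 f)) :
    ∃ ns : ℕ → ℕ, StrictMono ns ∧
      ∀ᵐ q ∂(μST N p T), ∀ i, Tendsto (fun k => F (ns k) i q) atTop (𝓝 (f i q)) := by
  have hi : ∀ i, Tendsto (fun k => F k i) atTop (𝓝 (f i)) := fun i =>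
    ((PiLp.continuous_apply 2 (fun _ : HIdx N p => Lp ℝ 2 (μST N p T)) i).tendsto f).comp hF
  have key : ∀ s : Finset (HIdx N p), ∃ ns : ℕ → ℕ, StrictMono ns ∧
      ∀ᵐ q ∂(μST N p T), ∀ i ∈ s, Tendsto (fun k => F (ns k) i q) atTop (𝓝 (f i q)) := by
    intro s
    induction s using Finset.induction_on with
    | empty => exact ⟨id, strictMono_id, by simp⟩
    | insert j s _ ih =>
      obtain ⟨ns, hns, hae⟩ := ih
      obtain ⟨ms, hms, hae'⟩ := (tendstoInMeasure_of_tendsto_Lp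
        ((hi j).comp hns.tendsto_atTop)).exists_seq_tendsto_ae
      refine ⟨ns ∘ ms, hns.comp hms, ?_⟩
      filter_upwards [hae, hae'] with q h1 h2 i his
      rcases Finset.mem_insert.1 his with rfl | his
      · exact h2
      · exact (h1 i his).comp hms.tendsto_atTop
  obtain ⟨ns, hns, hae⟩ := key Finset.univ
  exact ⟨ns, hns, hae.mono fun q hq i => hq i (Finset.mem_univ i)⟩

theorem IsBdd.of_tendsto {F : ℕ → HSp N p T} {f : HSp N p T} (hF : ∀ k, IsBdd (F k))
    (hae : ∀ᵐ q ∂(μST N p T), ∀ i, Tendsto (fun k => F k i q) atTop (𝓝 (f i q))) : IsBdd f := by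
  filter_upwards [hae, ae_all_iff.2 hF] with q hq hb i
  exact le_of_tendsto (hq (Sum.inr i)).abs (Eventually.of_forall fun k => hb k i)

theorem tendsto_Bfield {F : ℕ → HSp N p T} {f : HSp N p T} {q : ℝ × Pt N p}
    (hq : ∀ i, Tendsto (fun k => F k i q) atTop (𝓝 (f i q))) (a b : VIdx N p) :
    Tendsto (fun k => Bfield (F k) q.1 q.2 a b) atTop (𝓝 (Bfield f q.1 q.2 a b)) := by
  simp only [Bfield, Matrix.of_apply]
  exact ((hq _).add (hq _)).div_const 2

theorem tendsto_pairing (h : GoodWeight T W D) {F : ℕ → HSp N p T} {f : HSp N p T}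
    (hF : ∀ k, IsBdd (F k)) (hlim : Tendsto F atTop (𝓝 f))
    (hae : ∀ᵐ q ∂(μST N p T), ∀ i, Tendsto (fun k => F k i q) atTop (𝓝 (f i q))) :
    Tendsto (fun k => pairing W D (F k)) atTop (𝓝 (pairing W D f)) := by
  have hf : IsBdd f := IsBdd.of_tendsto hF hae
  have he : ∀ g : HSp N p T, IsBdd g → pairing W D g = _ := fun g hg =>
    h.integral_eq (memL2V_Efield g) hg.memLinfS
  rw [he f hf]
  simp only [fun k => he (F k) (hF k)]
  refine (tendsto_finsetSum _ fun a _ => tendsto_finsetSum _ fun b _ => ?_).add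
    (tendsto_finsetSum _ fun a _ => ?_)
  · refine tendsto_integral_of_dominated_convergence (fun q => 5 * |D q a b|)
      (fun k => (h.integrable_matrix (hF k).memLinfS a b).aestronglyMeasurable)
      ((h.2 a b).abs.const_mul 5) (fun k => ?_) ?_
    · filter_upwards [(hF k).Bfield] with q hq
      rw [norm_mul, Real.norm_eq_abs, Real.norm_eq_abs]
      exact mul_le_mul_of_nonneg_right (hq a b) (abs_nonneg _)
    · filter_upwards [hae] with q hq
      exact (tendsto_Bfield hq a b).mul_const _
  · have hinner : ∀ g : HSp N p T, ∫ q, Efield g q.1 q.2 a * W q a ∂(μST N p T)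
        = inner ℝ ((h.1 a).toLp _) (g (Sum.inl a)) := by
      intro g
      rw [L2.inner_def]
      refine integral_congr_ae ?_
      filter_upwards [(h.1 a).coeFn_toLp] with q hq
      rw [hq]
      simp [Efield]
    simp only [hinner]
    exact tendsto_const_nhds.inner (((PiLp.continuous_apply 2
      (fun _ : HIdx N p => Lp ℝ 2 (μST N p T)) (Sum.inl a)).tendsto f).comp hlim)

end Fields

section FeasibleSet

variable {N p : ℕ} {T : ℝ} {v₀ : Pt N p → Vec N p} {vb : ℝ → Pt N p → Vec N p}

/-- Representatives of dual admissible pairs whose dual objective is at least `c`. -/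
def feasSet (T : ℝ) (v₀ : Pt N p → Vec N p) (vb : ℝ → Pt N p → Vec N p) (c : ℝ) :
    Set (HSp N p T) :=
  {f | IsBdd f ∧ (∀ᵐ q ∂(μST N p T), ((1 : SymM N p) + 2 • Bfield f q.1 q.2).PosSemidef) ∧
    ConstraintEB N p T (Efield f) (Bfield f) ∧
    ∀ z M, KAdm N p T z M →
      c ≤ ∫ q, dualDensity v₀ vb (Efield f) z (Bfield f) M q ∂(μST N p T)}

theorem feasSet_antitone : Antitone (feasSet T v₀ vb) :=
  fun _ _ hcd _ hf => ⟨hf.1, hf.2.1, hf.2.2.1, fun z M h => hcd.trans (hf.2.2.2 z M h)⟩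

theorem dualAdmissible_of_mem_feasSet {c : ℝ} {f : HSp N p T} (hf : f ∈ feasSet T v₀ vb c) :
    DualAdmissible N p T (Efield f) (Bfield f) :=
  ⟨⟨memL2V_Efield f, hf.1.memLinfS, hf.2.2.1⟩, hf.2.1⟩

theorem le_dualObj_of_mem_feasSet (hv₀ : MemL2Om N p v₀) (hvb : MemL2V N p T vb) {c : ℝ}
    {f : HSp N p T} (hf : f ∈ feasSet T v₀ vb c) :
    (c : EReal) ≤ dualObj N p T v₀ vb (Efield f) (Bfield f) :=
  (le_dualObj_iff hv₀ hvb (memL2V_Efield f) hf.1.memLinfS c).2 hf.2.2.2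

theorem feasSet_nonempty (hN : 2 ≤ N) (hv₀ : MemL2Om N p v₀) (hvb : MemL2V N p T vb) {c : ℝ}
    {E : ℝ → Pt N p → Vec N p} {B : ℝ → Pt N p → SymM N p} (h : DualAdmissible N p T E B)
    (hc : (c : EReal) ≤ dualObj N p T v₀ vb E B) : (feasSet T v₀ vb c).Nonempty := by
  have hE := h.1.1
  have hB := h.1.2.1
  have hB5 := h.ae_bound hN
  have hBL : ∀ i : VIdx N p × VIdx N p,
      MemLp (fun q : ℝ × Pt N p => B q.1 q.2 i.1 i.2) 2 (μST N p T) := fun i =>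
    MemLp.of_bound (hB.1 i.1 i.2).aestronglyMeasurable 5 (hB5.mono fun q hq => hq i.1 i.2)
  set f : HSp N p T := WithLp.toLp 2 fun i => Sum.rec (fun a => (hE.memLp a).toLp _)
    (fun i => (hBL i).toLp _) i with hfdef
  have hfl : ∀ᵐ q ∂(μST N p T), ∀ a, f (Sum.inl a) q = E q.1 q.2 a :=
    ae_all_iff.2 fun a => (hE.memLp a).coeFn_toLp
  have hfr : ∀ᵐ q ∂(μST N p T), ∀ i, f (Sum.inr i) q = B q.1 q.2 i.1 i.2 :=
    ae_all_iff.2 fun i => (hBL i).coeFn_toLp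
  have hfE : ∀ᵐ q ∂(μST N p T), Efield f q.1 q.2 = E q.1 q.2 :=
    hfl.mono fun q hq => funext hq
  have hfB : ∀ᵐ q ∂(μST N p T), Bfield f q.1 q.2 = B q.1 q.2 := by
    filter_upwards [hfr] with q hq
    ext a b
    simp only [Bfield, Matrix.of_apply]
    rw [hq, hq, (hB.2.1 q.1 q.2).apply a b]
    ring
  have hbd : IsBdd f := by
    filter_upwards [hfr, hB5] with q h1 h2 i
    rw [h1]
    exact h2 _ _
  refine ⟨f, hbd, ?_, ?_, fun z M hK => ?_⟩
  · filter_upwards [hfB, h.2] with q h1 h2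
    rwa [h1]
  · rw [constraintEB_iff (memL2V_Efield f) hbd.memLinfS]
    intro Ψ hΨ
    rw [← (constraintEB_iff hE hB).1 h.1.2.2 Ψ hΨ]
    refine integral_congr_ae ?_
    filter_upwards [hfE, hfB] with q h1 h2
    simp only [pairDensity, h1, h2]
  · refine ((le_dualObj_iff hv₀ hvb hE hB c).1 hc z M hK).trans (le_of_eq ?_)
    refine integral_congr_ae ?_
    filter_upwards [hfE, hfB] with q h1 h2
    simp only [dualDensity, h1, h2]

theorem integral_dualDensity_fields (hv₀ : MemL2Om N p v₀) (hvb : MemL2V N p T vb)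
    {f : HSp N p T} (hf : IsBdd f) {z : ℝ → Pt N p → Vec N p} {M : ℝ → Pt N p → SymM N p}
    (hK : KAdm N p T z M) :
    ∫ q, dualDensity v₀ vb (Efield f) z (Bfield f) M q ∂(μST N p T)
      = ∫ q, freeDensity vb z M q ∂(μST N p T)
        + pairing (fun q => z q.1 q.2 - v₀ q.2) (fun q => M q.1 q.2) f :=
  integral_dualDensity_eq hv₀ hvb (memL2V_Efield f) hf.memLinfS hK.1 hK.2.1

theorem convex_feasSet (hv₀ : MemL2Om N p v₀) (hvb : MemL2V N p T vb) (c : ℝ) :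
    Convex ℝ (feasSet T v₀ vb c) := by
  intro f hf g hg α β hα hβ hαβ
  have hbd := hf.1.combo hg.1 hα hβ hαβ
  refine ⟨hbd, ?_, ?_, fun z M hK => ?_⟩
  · filter_upwards [fields_combo f g α β, hf.2.1, hg.2.1] with q hq h1 h2
    have he : (1 : SymM N p) + 2 • Bfield (α • f + β • g) q.1 q.2
        = α • ((1 : SymM N p) + 2 • Bfield f q.1 q.2)
          + β • ((1 : SymM N p) + 2 • Bfield g q.1 q.2) := by
      rw [hq.2]
      ext a b
      simp only [one_add_two_smul_apply, Matrix.add_apply (α • _), Matrix.smul_apply (α),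
        Matrix.smul_apply (β), smul_eq_mul]
      linear_combination (-(1 : SymM N p) a b) * hαβ
    rw [he]
    exact (h1.smul hα).add (h2.smul hβ)
  · rw [constraintEB_iff (memL2V_Efield _) hbd.memLinfS]
    intro Ψ hΨ
    have h1 := (constraintEB_iff (memL2V_Efield f) hf.1.memLinfS).1 hf.2.2.1 Ψ hΨ
    have h2 := (constraintEB_iff (memL2V_Efield g) hg.1.memLinfS).1 hg.2.2.1 Ψ hΨ
    have h3 := pairing_combo (hΨ.goodWeight T) hf.1 hg.1 α β
    simp only [pairing] at h3
    rw [h3, h1, h2, mul_zero, mul_zero, add_zero]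
  · have h1 := hf.2.2.2 z M hK
    have h2 := hg.2.2.2 z M hK
    rw [integral_dualDensity_fields hv₀ hvb hf.1 hK] at h1
    rw [integral_dualDensity_fields hv₀ hvb hg.1 hK] at h2
    rw [integral_dualDensity_fields hv₀ hvb hbd hK,
      pairing_combo (goodWeight_of_kAdm hv₀ hK.1 hK.2.1) hf.1 hg.1]
    obtain rfl : β = 1 - α := by linarith
    nlinarith [mul_le_mul_of_nonneg_left h1 hα, mul_le_mul_of_nonneg_left h2 hβ]

theorem posSemidef_of_tendsto {ι : Type*} [Fintype ι] {F : ℕ → Matrix ι ι ℝ} {A : Matrix ι ι ℝ}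
    (hF : ∀ k, (F k).PosSemidef) (h : ∀ a b, Tendsto (fun k => F k a b) atTop (𝓝 (A a b))) :
    A.PosSemidef := by
  refine Matrix.PosSemidef.of_dotProduct_mulVec_nonneg ?_ fun x => ?_
  · ext a b
    refine tendsto_nhds_unique (h b a) ?_
    simpa using (h a b).congr fun k => ((hF k).isHermitian.apply a b).symm
  · refine ge_of_tendsto (x := atTop) (f := fun k => star x ⬝ᵥ (F k) *ᵥ x) ?_
      (Eventually.of_forall fun k => (hF k).dotProduct_mulVec_nonneg x)
    simp only [dotProduct, Matrix.mulVec]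
    exact tendsto_finsetSum _ fun a _ => (tendsto_finsetSum _ fun b _ =>
      (h a b).mul_const _).const_mul _

theorem isClosed_feasSet (hv₀ : MemL2Om N p v₀) (hvb : MemL2V N p T vb) (c : ℝ) :
    IsClosed (feasSet T v₀ vb c) := by
  refine IsSeqClosed.isClosed fun G f hG hlim => ?_
  obtain ⟨ns, hns, hae⟩ := exists_subseq_tendsto_ae hlim
  set F : ℕ → HSp N p T := fun k => G (ns k) with hFdef
  have hF : ∀ k, F k ∈ feasSet T v₀ vb c := fun k => hG _
  have hFlim : Tendsto F atTop (𝓝 f) := hlim.comp hns.tendsto_atTop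
  have hFbd : ∀ k, IsBdd (F k) := fun k => (hF k).1
  have hbd : IsBdd f := IsBdd.of_tendsto hFbd hae
  refine ⟨hbd, ?_, ?_, fun z M hK => ?_⟩
  · filter_upwards [hae, ae_all_iff.2 fun k => (hF k).2.1] with q h1 h2
    refine posSemidef_of_tendsto h2 fun a b => ?_
    simp only [one_add_two_smul_apply]
    exact ((tendsto_Bfield h1 a b).const_mul 2).const_add _
  · rw [constraintEB_iff (memL2V_Efield f) hbd.memLinfS]
    intro Ψ hΨ
    refine tendsto_nhds_unique (tendsto_pairing (hΨ.goodWeight T) hFbd hFlim hae) ?_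
    have h0 : ∀ k, pairing (fun q => Lop N p (Ψ q.1) q.2) (fun q => dtPsi N p Ψ q.1 q.2) (F k)
        = 0 := fun k =>
      (constraintEB_iff (memL2V_Efield _) (hFbd k).memLinfS).1 (hF k).2.2.1 Ψ hΨ
    simp only [h0]
    exact tendsto_const_nhds
  · rw [integral_dualDensity_fields hv₀ hvb hbd hK]
    refine ge_of_tendsto ((tendsto_pairing (goodWeight_of_kAdm hv₀ hK.1 hK.2.1) hFbd hFlim
      hae).const_add _) (Eventually.of_forall fun k => ?_)
    have := (hF k).2.2.2 z M hK
    rwa [integral_dualDensity_fields hv₀ hvb (hFbd k) hK] at this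

theorem norm_sq_eq_integral {α : Type*} [MeasurableSpace α] {μ : Measure α} (g : Lp ℝ 2 μ) :
    ‖g‖ ^ 2 = ∫ q, g q ^ 2 ∂μ := by
  rw [← real_inner_self_eq_norm_sq, L2.inner_def]
  refine integral_congr_ae (Eventually.of_forall fun q => ?_)
  simp [pow_two]

theorem isBounded_feasSet (hv₀ : MemL2Om N p v₀) (hvb : MemL2V N p T vb) (c : ℝ) :
    Bornology.IsBounded (feasSet T v₀ vb c) := by
  set R : ℝ := 2 * (4 * ellConst N p * (upperConst T v₀ vb - c))
    + 2 * ∫ q, ∑ a, vb q.1 q.2 a ^ 2 ∂(μST N p T)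
    + ∑ _i : VIdx N p × VIdx N p, ∫ _q, (25 : ℝ) ∂(μST N p T) with hR
  have hkey : ∀ f ∈ feasSet T v₀ vb c, ‖f‖ ^ 2 ≤ R := by
    intro f hf
    have hEf := memL2V_Efield f
    obtain ⟨z, M, hK, hle⟩ := exists_dualDensity_le hv₀ hvb hEf hf.1.memLinfS hf.1.Bfield
    have hc := (hf.2.2.2 z M hK).trans hle
    have hpos := ellConst_pos N p
    have hQ : ∫ q, ∑ a, (Efield f q.1 q.2 a - vb q.1 q.2 a) ^ 2 ∂(μST N p T)
        ≤ 4 * ellConst N p * (upperConst T v₀ vb - c) := by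
      have h1 : 1 / (4 * ellConst N p)
          * ∫ q, ∑ a, (Efield f q.1 q.2 a - vb q.1 q.2 a) ^ 2 ∂(μST N p T)
          ≤ upperConst T v₀ vb - c := by linarith
      rw [one_div, inv_mul_le_iff₀ (by positivity)] at h1
      exact h1
    have hE : ∫ q, ∑ a, Efield f q.1 q.2 a ^ 2 ∂(μST N p T)
        ≤ 2 * ∫ q, ∑ a, (Efield f q.1 q.2 a - vb q.1 q.2 a) ^ 2 ∂(μST N p T)
          + 2 * ∫ q, ∑ a, vb q.1 q.2 a ^ 2 ∂(μST N p T) := by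
      have i1 : Integrable (fun q : ℝ × Pt N p =>
        ∑ a, (Efield f q.1 q.2 a - vb q.1 q.2 a) ^ 2) (μST N p T) := (hEf.sub hvb).2
      have i2 : Integrable (fun q : ℝ × Pt N p => ∑ a, vb q.1 q.2 a ^ 2) (μST N p T) := hvb.2
      rw [← integral_const_mul, ← integral_const_mul,
        ← integral_add (i1.const_mul 2) (i2.const_mul 2)]
      refine integral_mono hEf.2 ((i1.const_mul 2).add (i2.const_mul 2)) fun q => ?_
      simp only [Finset.mul_sum, ← Finset.sum_add_distrib]
      refine Finset.sum_le_sum fun a _ => ?_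
      nlinarith [sq_nonneg (Efield f q.1 q.2 a - 2 * vb q.1 q.2 a)]
    have hB : ∀ i, ∫ q, f (Sum.inr i) q ^ 2 ∂(μST N p T) ≤ ∫ _q, (25 : ℝ) ∂(μST N p T) := by
      intro i
      refine integral_mono_ae (Lp.memLp (f (Sum.inr i))).integrable_sq (integrable_const _) ?_
      filter_upwards [hf.1] with q hq
      have := abs_le.1 (hq i)
      nlinarith [this.1, this.2]
    have hEsum : ∫ q, ∑ a, Efield f q.1 q.2 a ^ 2 ∂(μST N p T)
        = ∑ a, ∫ q, f (Sum.inl a) q ^ 2 ∂(μST N p T) :=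
      integral_finsetSum _ fun a _ => (hEf.memLp a).integrable_sq
    rw [PiLp.norm_sq_eq_of_L2, Fintype.sum_sum_type]
    simp only [norm_sq_eq_integral]
    rw [← hEsum]
    have := Finset.sum_le_sum fun (i : VIdx N p × VIdx N p) (_ : i ∈ Finset.univ) => hB i
    linarith
  refine (Metric.isBounded_closedBall (x := (0 : HSp N p T)) (r := R + 1)).subset fun f hf => ?_
  rw [mem_closedBall_zero_iff]
  nlinarith [hkey f hf, norm_nonneg f, sq_nonneg (‖f‖ - 1)]

theorem dualObj_le_upperConst (hN : 2 ≤ N) (hv₀ : MemL2Om N p v₀) (hvb : MemL2V N p T vb)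
    {E : ℝ → Pt N p → Vec N p} {B : ℝ → Pt N p → SymM N p} (h : DualAdmissible N p T E B) :
    dualObj N p T v₀ vb E B ≤ (upperConst T v₀ vb : ℝ) := by
  refine EReal.ge_of_forall_gt_iff_ge.1 fun c hc => ?_
  obtain ⟨z, M, hK, hle⟩ := exists_dualDensity_le hv₀ hvb h.1.1 h.1.2.1 (h.ae_bound hN)
  have hc' := ((le_dualObj_iff hv₀ hvb h.1.1 h.1.2.1 c).1 hc.le z M hK).trans hle
  have hnn : 0 ≤ ∫ q, ∑ a, (E q.1 q.2 a - vb q.1 q.2 a) ^ 2 ∂(μST N p T) :=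
    integral_nonneg fun q => Finset.sum_nonneg fun _ _ => sq_nonneg _
  have hpos := ellConst_pos N p
  have : 0 ≤ 1 / (4 * ellConst N p)
      * ∫ q, ∑ a, (E q.1 q.2 a - vb q.1 q.2 a) ^ 2 ∂(μST N p T) := by positivity
  exact EReal.coe_le_coe_iff.2 (by linarith)

end FeasibleSet

/-- Existence of a variational dual solution, Theorem 2.8 of the paper.
For `N ≥ 2`, any `v₀ ∈ L²(Ω;ℝⁿ)` and any base state `v̄ ∈ L²((0,T)×Ω;ℝⁿ)`, the dual
problem defining `𝒥(v₀,v̄,T)` has a maximizer `(E,B)` in the class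
`L²((0,T)×Ω;ℝⁿ) × L^∞((0,T)×Ω;Sym(n,ℝ))`, and
`ℭ(Πv̄,Πv₀) ≤ 𝒥(v₀,v̄,T) < +∞`. -/
theorem stmt3 (N p : ℕ) (hN : 2 ≤ N) (hp : 1 ≤ p) (T : ℝ) (hT : 0 < T)
    (v₀ : Pt N p → Vec N p) (hv₀ : MemL2Om N p v₀)
    (vb : ℝ → Pt N p → Vec N p) (hvb : MemL2V N p T vb) :
    (∃ (E : ℝ → Pt N p → Vec N p) (B : ℝ → Pt N p → SymM N p),
      DualAdmissible N p T E B ∧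
      dualObj N p T v₀ vb E B = Jfun N p T v₀ vb) ∧
    ((CCfun N p T (fun t => avg N p (vb t)) (avg N p v₀) : ℝ) : EReal)
      ≤ Jfun N p T v₀ vb ∧
    Jfun N p T v₀ vb < (⊤ : EReal) := by
  have hle : ∀ E B, DualAdmissible N p T E B →
      dualObj N p T v₀ vb E B ≤ Jfun N p T v₀ vb := fun E B h =>
    le_iSup (fun EB : {EB : (ℝ → Pt N p → Vec N p) × (ℝ → Pt N p → SymM N p) //
      DualAdmissible N p T EB.1 EB.2} => dualObj N p T v₀ vb EB.1.1 EB.1.2) ⟨(E, B), h⟩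
  have hlow := (CCfun_le_dualObj hv₀ hvb).trans (hle _ _ (dualAdmissible_avg hvb))
  have htop : Jfun N p T v₀ vb < (⊤ : EReal) :=
    (iSup_le fun EB => dualObj_le_upperConst hN hv₀ hvb EB.2).trans_lt (EReal.coe_lt_top _)
  refine ⟨?_, hlow, htop⟩
  obtain ⟨s, hs⟩ : ∃ s : ℝ, (s : EReal) = Jfun N p T v₀ vb :=
    ⟨_, EReal.coe_toReal htop.ne ((EReal.bot_lt_coe _).trans_le hlow).ne'⟩
  have hne : ∀ k : ℕ, (feasSet T v₀ vb (s - 1 / ((k : ℝ) + 1))).Nonempty := by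
    intro k
    have hlt : ((s - 1 / ((k : ℝ) + 1) : ℝ) : EReal) < Jfun N p T v₀ vb := by
      rw [← hs, EReal.coe_lt_coe_iff]
      exact sub_lt_self _ Nat.one_div_pos_of_nat
    obtain ⟨EB, hEB⟩ := lt_iSup_iff.1 hlt
    exact feasSet_nonempty hN hv₀ hvb EB.2 hEB.le
  obtain ⟨f, hf⟩ := nonempty_iInter_of_antitone_convex
    (fun k : ℕ => feasSet T v₀ vb (s - 1 / ((k : ℝ) + 1)))
    (fun k l hkl => feasSet_antitone (sub_le_sub_left (Nat.one_div_le_one_div hkl) s)) hne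
    (fun k => convex_feasSet hv₀ hvb _) (fun k => isClosed_feasSet hv₀ hvb _)
    (isBounded_feasSet hv₀ hvb _)
  rw [Set.mem_iInter] at hf
  have hadm := dualAdmissible_of_mem_feasSet (hf 0)
  refine ⟨Efield f, Bfield f, hadm, le_antisymm (hle _ _ hadm) ?_⟩
  rw [← hs]
  have hlim : Tendsto (fun k : ℕ => ((s - 1 / ((k : ℝ) + 1) : ℝ) : EReal)) atTop
      (𝓝 (s : EReal)) := by
    rw [EReal.tendsto_coe]
    simpa using (tendsto_one_div_add_atTop_nhds_zero_nat (𝕜 := ℝ)).const_sub s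
  exact le_of_tendsto hlim (Eventually.of_forall fun k => le_dualObj_of_mem_feasSet hv₀ hvb (hf k))


end NashDual
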